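/- arXiv:2512.08519 — 3 statements merged into one kernel-verified Lean document; each statement's English description precedes it below -/
import Mathlib

section
/- Let T : X → X be an operator. (1) If T is chaotic (hypercyclic with a dense set of periodic points), then T is mildly mixing. (2) If T^p is mildly mixing for some integer p ≥ 1, then T is mildly mixing. -/
open Set Topology Function Filter
open scoped ENNReal

/- ### Basic dynamical notions -/

/-- The return time set `N(U,V) = {n ∈ ℕ : T^n(U) ∩ V ≠ ∅}`. -/
def nset {X : Type*} (T : X → X) (U V : Set X) : Set ℕ :=
  {n : ℕ | ∃ x ∈ U, T^[n] x ∈ V}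

/-- A Furstenberg family: nonempty, hereditary upward, not containing `∅`. -/
def IsFamily (F : Set (Set ℕ)) : Prop :=
  F.Nonempty ∧ (∀ ⦃A B : Set ℕ⦄, A ∈ F → A ⊆ B → B ∈ F) ∧ ∅ ∉ F

/-- `T` is `F`-transitive. -/
def FTrans {X : Type*} [TopologicalSpace X] (T : X → X) (F : Set (Set ℕ)) : Prop :=
  ∀ U V : Set X, IsOpen U → IsOpen V → U.Nonempty → V.Nonempty → nset T U V ∈ F

/-- Direct sum (product) of two maps. -/
def prodMap' {X Y : Type*} (T : X → X) (S : Y → Y) : X × Y → X × Y :=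
  fun p => (T p.1, S p.2)

/-- `T` is `F`-mixing: `T × T` is `F`-transitive. -/
def FMix {X : Type*} [TopologicalSpace X] (T : X → X) (F : Set (Set ℕ)) : Prop :=
  FTrans (prodMap' T T) F

/-- Topological transitivity. -/
def TopTrans {X : Type*} [TopologicalSpace X] (T : X → X) : Prop :=
  ∀ U V : Set X, IsOpen U → IsOpen V → U.Nonempty → V.Nonempty → (nset T U V).Nonempty

/-- Weak mixing: `T × T` is topologically transitive. -/
def WMix {X : Type*} [TopologicalSpace X] (T : X → X) : Prop :=
  TopTrans (prodMap' T T)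

/-- Hypercyclicity: some point has dense orbit. -/
def HypercyclicMap {X : Type*} [TopologicalSpace X] (T : X → X) : Prop :=
  ∃ x : X, Dense (Set.range fun n : ℕ => T^[n] x)

/-- Weak disjointness: the direct sum is hypercyclic. -/
def WeaklyDisjoint {X Y : Type*} [TopologicalSpace X] [TopologicalSpace Y]
    (T : X → X) (S : Y → Y) : Prop :=
  HypercyclicMap (prodMap' T S)

/-- The family generated by the return time sets of `T`. -/
def NTfam {X : Type*} [TopologicalSpace X] (T : X → X) : Set (Set ℕ) :=
  {A : Set ℕ | ∃ U V : Set X, IsOpen U ∧ IsOpen V ∧ U.Nonempty ∧ V.Nonempty ∧ nset T U V ⊆ A}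

/- ### Combinatorial families -/

/-- `(A + i) ∩ ℕ` for `i : ℤ`. -/
def shiftSet (A : Set ℕ) (i : ℤ) : Set ℕ := {n : ℕ | ∃ m ∈ A, (n : ℤ) = (m : ℤ) + i}

/-- A shift-invariant family. -/
def ShiftInvariant (F : Set (Set ℕ)) : Prop := ∀ A ∈ F, ∀ i : ℤ, shiftSet A i ∈ F

/-- A shift₊-invariant family: `A + i ∈ F` for `i : ℕ`. -/
def ShiftPlusInvariant (F : Set (Set ℕ)) : Prop :=
  ∀ A ∈ F, ∀ i : ℕ, (fun n => n + i) '' A ∈ F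

/-- A thick family: `⋂_{i=0}^{k} ((A - i) ∩ ℕ) ∈ F` for all `A ∈ F`, `k ∈ ℕ`. -/
def ThickFamily (F : Set (Set ℕ)) : Prop :=
  ∀ A ∈ F, ∀ k : ℕ, {n : ℕ | ∀ i ≤ k, n + i ∈ A} ∈ F

/-- The dual family `F*`. -/
def dualFam (F : Set (Set ℕ)) : Set (Set ℕ) := {A | ∀ B ∈ F, (A ∩ B).Nonempty}

/-- A full family. -/
def FullFamily (F : Set (Set ℕ)) : Prop :=
  ∀ A ∈ F, ∀ B ∈ dualFam F, (A ∩ B).Infinite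

/-- `F̃`: the members `A` of `F` with `⋂_{i=-k}^{k} ((A + i) ∩ ℕ) ∈ F` for all `k ∈ ℕ`. -/
def tildeFam (F : Set (Set ℕ)) : Set (Set ℕ) :=
  {A ∈ F | ∀ k : ℕ, {n : ℕ | ∀ i : ℤ, |i| ≤ (k : ℤ) → n ∈ shiftSet A i} ∈ F}

/-- A thick subset of `ℕ`: contains arbitrarily long blocks of consecutive integers. -/
def IsThickSet (A : Set ℕ) : Prop := ∀ k : ℕ, ∃ n : ℕ, ∀ i ≤ k, n + i ∈ A

/-- A syndetic subset of `ℕ` (bounded gaps). -/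
def IsSyndetic (A : Set ℕ) : Prop := ∃ g : ℕ, ∀ n : ℕ, ∃ m ∈ A, n ≤ m ∧ m ≤ n + g

/-- A piecewise syndetic subset: intersection of a syndetic and a thick set. -/
def IsPiecewiseSyndetic (A : Set ℕ) : Prop :=
  ∃ S T : Set ℕ, IsSyndetic S ∧ IsThickSet T ∧ A = S ∩ T

/-- An IP-set. -/
def IsIPSet (A : Set ℕ) : Prop :=
  ∃ x : ℕ → ℕ, {n | x n ≠ 0}.Infinite ∧ ∀ s : Finset ℕ, s.Nonempty → (∑ i ∈ s, x i) ∈ A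

/-- `(A - A) ∩ ℕ` for `A ⊆ ℕ`: positive differences of distinct elements. -/
def diffSet (A : Set ℕ) : Set ℕ := {k | ∃ m ∈ A, ∃ n ∈ A, n < m ∧ k = m - n}

/-- The family `Δ*_ip`. -/
def deltaIPStar : Set (Set ℕ) :=
  {A | ∀ F : Set ℕ, IsIPSet F → (A ∩ diffSet F).Nonempty}

/- ### Operators on Fréchet spaces -/

/-- A (continuous linear) operator on an infinite-dimensional separable Fréchet space
(a complete metrizable locally convex topological vector space) over `ℝ` or `ℂ`
(an `RCLike` field). -/
structure FrechetOp where
  𝕜 : Type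
  [instField : RCLike 𝕜]
  X : Type
  [instAdd : AddCommGroup X]
  [instMod : Module 𝕜 X]
  [instUnif : UniformSpace X]
  [instUAG : IsUniformAddGroup X]
  [instSMul : ContinuousSMul 𝕜 X]
  [instComplete : CompleteSpace X]
  [instMetrizable : TopologicalSpace.MetrizableSpace X]
  [instSeparable : TopologicalSpace.SeparableSpace X]
  [instModR : Module ℝ X]
  [instTower : IsScalarTower ℝ 𝕜 X]
  [instLC : LocallyConvexSpace ℝ X]
  infDim : ¬ FiniteDimensional 𝕜 X
  T : X → X
  linear : IsLinearMap 𝕜 T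
  cont : Continuous T

attribute [instance] FrechetOp.instAdd FrechetOp.instMod
  FrechetOp.instUnif FrechetOp.instUAG FrechetOp.instSMul FrechetOp.instComplete
  FrechetOp.instMetrizable FrechetOp.instSeparable FrechetOp.instModR
  FrechetOp.instTower FrechetOp.instLC

/-- A bundled Fréchet-space operator is hypercyclic. -/
def FrechetOp.Hypercyclic (S : FrechetOp) : Prop := HypercyclicMap S.T

/-- A bundled Fréchet-space operator is invertible (a linear homeomorphism). -/
def FrechetOp.Invertible (S : FrechetOp) : Prop :=
  ∃ T' : S.X → S.X, Continuous T' ∧ (∀ x, T' (S.T x) = x) ∧ (∀ x, S.T (T' x) = x)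

/-- Mild mixing: weakly disjoint from every hypercyclic operator
(on every infinite-dimensional separable Fréchet space). -/
def MildlyMixing {X : Type*} [TopologicalSpace X] (T : X → X) : Prop :=
  ∀ S : FrechetOp, S.Hypercyclic → WeaklyDisjoint T S.T

/-- Topological ergodicity: all return time sets are syndetic. -/
def TopErgodic {X : Type*} [TopologicalSpace X] (T : X → X) : Prop :=
  ∀ U V : Set X, IsOpen U → IsOpen V → U.Nonempty → V.Nonempty → IsSyndetic (nset T U V)

/-- The `F`-Mixing Criterion for a map `T`. -/
def FMixCriterion {X : Type*} [TopologicalSpace X] [Zero X] (T : X → X)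
    (F : Set (Set ℕ)) : Prop :=
  ∃ X₀ Y₀ : Set X, Dense X₀ ∧ Dense Y₀ ∧ ∃ S : ℕ → X → X,
    ∀ x₀ ∈ X₀, ∀ y₀ ∈ Y₀, ∀ O ∈ nhds ((0, 0, y₀) : X × X × X),
      {n : ℕ | (T^[n] x₀, S n y₀, T^[n] (S n y₀)) ∈ O} ∈ F

/- ### Bilateral weighted backward shifts on `ℓᵖ(ℤ)` and `c₀(ℤ)` -/

/-- `B` is the bilateral weighted backward shift with (positive, bounded) weight `w` on
`ℓᵖ(ℤ)`; the condition that `1/w` is bounded makes it invertible. -/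
def IsInvertibleWBSlp (𝕜 : Type) [RCLike 𝕜] (p : ℝ≥0∞) [Fact (1 ≤ p)] (w : ℤ → ℝ)
    (B : lp (fun _ : ℤ => 𝕜) p →L[𝕜] lp (fun _ : ℤ => 𝕜) p) : Prop :=
  (∀ n, 0 < w n) ∧ (∃ C : ℝ, ∀ n, w n ≤ C) ∧ (∃ c : ℝ, 0 < c ∧ ∀ n, c ≤ w n) ∧
    ∀ (x : lp (fun _ : ℤ => 𝕜) p) (n : ℤ), B x n = w (n + 1) • x (n + 1)

/-- `B` is the bilateral weighted backward shift with (positive, bounded) weight `w` on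
`c₀(ℤ)`; the condition that `1/w` is bounded makes it invertible. -/
def IsInvertibleWBSc0 (𝕜 : Type) [RCLike 𝕜] (w : ℤ → ℝ)
    (B : ZeroAtInftyContinuousMap ℤ 𝕜 →L[𝕜] ZeroAtInftyContinuousMap ℤ 𝕜) : Prop :=
  (∀ n, 0 < w n) ∧ (∃ C : ℝ, ∀ n, w n ≤ C) ∧ (∃ c : ℝ, 0 < c ∧ ∀ n, c ≤ w n) ∧
    ∀ (x : ZeroAtInftyContinuousMap ℤ 𝕜) (n : ℤ), B x n = w (n + 1) • x (n + 1)

section AnsariAux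

theorem aux_iter_apply {E : Type*} [AddCommGroup E] [Module ℝ E] [TopologicalSpace E]
    (T : E →L[ℝ] E) (f : E →L[ℝ] ℝ) (l : ℝ) (h : ∀ y, f (T y) = l * f y) (x : E) (n : ℕ) :
    f (T^[n] x) = l ^ n * f x := by
  induction n with
  | zero => simp
  | succ n ih => rw [Function.iterate_succ_apply', h, ih]; ring

theorem aux_no_eigen {E : Type*} [AddCommGroup E] [Module ℝ E] [TopologicalSpace E]
    (T : E →L[ℝ] E) (f : E →L[ℝ] ℝ) (hf : f ≠ 0) (l : ℝ) (h : ∀ y, f (T y) = l * f y) (x : E)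
    (hx : Dense (Set.range fun n : ℕ => T^[n] x)) : False := by
  have hs : Function.Surjective f := by
    have : ∃ v, f v ≠ 0 := by
      by_contra hc
      push Not at hc
      exact hf (ContinuousLinearMap.ext hc)
    obtain ⟨v, hv⟩ := this
    intro r
    refine ⟨(r / f v) • v, ?_⟩
    simp [hv]
  have key : ∀ C : Set ℝ, IsClosed C → (∀ n : ℕ, l ^ n * f x ∈ C) → ∀ r, r ∈ C := by
    intro C hC hn r
    obtain ⟨v, rfl⟩ := hs r
    have hc : IsClosed (f ⁻¹' C) := hC.preimage f.continuous
    have : (Set.range fun n : ℕ => T^[n] x) ⊆ f ⁻¹' C := by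
      rintro _ ⟨n, rfl⟩
      simp only [Set.mem_preimage]
      rw [aux_iter_apply T f l h]
      exact hn n
    exact closure_minimal this hc (hx v)
  have hbd : (∀ n : ℕ, |l ^ n * f x| ≤ |f x|) → False := by
    intro hb
    have := key {r | |r| ≤ |f x|} (isClosed_le continuous_abs continuous_const) hb (|f x| + 1)
    simp only [Set.mem_ofPred_eq] at this
    have h2 := le_abs_self (|f x| + 1)
    linarith
  rcases le_total |l| 1 with h1 | h1
  · apply hbd
    intro n
    rw [abs_mul, abs_pow]
    exact mul_le_of_le_one_left (abs_nonneg _) (pow_le_one₀ (abs_nonneg _) h1)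
  · have h0 : f x = 0 := by
      have := key {r | |f x| ≤ |r|} (isClosed_le continuous_const continuous_abs) (by
        intro n
        simp only [Set.mem_ofPred_eq]
        rw [abs_mul, abs_pow]
        exact le_mul_of_one_le_left (abs_nonneg _) (one_le_pow₀ h1)) 0
      simpa using this
    apply hbd
    intro n
    simp [h0]

variable {E : Type*} [AddCommGroup E] [Module ℝ E] [TopologicalSpace E] [IsTopologicalAddGroup E]
  [ContinuousSMul ℝ E] [LocallyConvexSpace ℝ E]

theorem aux_denseRange_of_functional (A : E →L[ℝ] E)
    (h : ∀ f : E →L[ℝ] ℝ, (∀ y, f (A y) = 0) → f = 0) : DenseRange A := by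
  by_contra hd
  have : ∃ v, v ∉ closure (Set.range A) := by
    by_contra hc
    push Not at hc
    exact hd hc
  obtain ⟨v, hv⟩ := this
  let R : Submodule ℝ E := (LinearMap.range (A : E →ₗ[ℝ] E)).topologicalClosure
  have hR : (R : Set E) = closure (Set.range A) := by
    rw [Submodule.topologicalClosure_coe]
    congr 1
  have hv' : v ∉ (R : Set E) := by rwa [hR]
  obtain ⟨f, u, hfu, hfv⟩ := geometric_hahn_banach_closed_point (s := (R : Set E)) (x := v)
    R.convex (by rw [hR]; exact isClosed_closure) hv'
  have hz : ∀ a ∈ R, f a = 0 := by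
    intro a ha
    by_contra hne
    have := hfu (((u + 1) / f a) • a) (R.smul_mem _ ha)
    rw [map_smul, smul_eq_mul, div_mul_cancel₀ _ hne] at this
    linarith
  have hf0 : f = 0 := by
    apply h
    intro y
    apply hz
    have : A y ∈ (R : Set E) := by rw [hR]; exact subset_closure ⟨y, rfl⟩
    exact this
  have h1 := hfu 0 R.zero_mem
  rw [hf0] at h1 hfv
  simp at h1 hfv
  linarith

theorem aux_orbit_dense_of_commute (T A : E →L[ℝ] E) (hA : DenseRange A)
    (hc : ∀ y, A (T y) = T (A y)) (x : E)
    (hx : Dense (Set.range fun n : ℕ => T^[n] x)) :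
    Dense (Set.range fun n : ℕ => T^[n] (A x)) := by
  have := hA.dense_image A.continuous hx
  rw [← Set.range_comp] at this
  convert this using 2
  funext n
  exact ((show Function.Commute A T from hc).iterate_right n x).symm

theorem aux_denseRange_self [T1Space E] [Nontrivial E] (T : E →L[ℝ] E) (x : E)
    (hx : Dense (Set.range fun n : ℕ => T^[n] x)) : DenseRange T := by
  haveI : ∀ z : E, (𝓝[≠] z).NeBot := fun z => Module.punctured_nhds_neBot ℝ E z
  refine (hx.diff_singleton x).mono ?_
  rintro _ ⟨⟨n, rfl⟩, hn⟩
  cases n with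
  | zero => simp at hn
  | succ n => exact ⟨T^[n] x, (Function.iterate_succ_apply' T n x).symm⟩

theorem aux_segment [T1Space E] [Nontrivial E] (T : E →L[ℝ] E) (x : E)
    (hx : Dense (Set.range fun n : ℕ => T^[n] x)) (t : ℝ) (h0 : 0 ≤ t) (h1 : t ≤ 1) :
    Dense (Set.range fun n : ℕ => T^[n] ((1 - t) • x + t • T x)) := by
  let A : E →L[ℝ] E := (1 - t) • ContinuousLinearMap.id ℝ E + t • T
  have hAy : ∀ y, A y = (1 - t) • y + t • T y := fun y => rfl
  have hA : DenseRange A := by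
    by_cases ht0 : t = 0
    · have : ∀ y, A y = y := by intro y; rw [hAy, ht0]; simp
      intro y
      exact subset_closure ⟨y, this y⟩
    apply aux_denseRange_of_functional
    intro f hf
    by_contra hne
    refine aux_no_eigen T f hne (-(1 - t) / t) ?_ x hx
    intro y
    have := hf y
    rw [hAy, map_add, map_smul, map_smul, smul_eq_mul, smul_eq_mul] at this
    field_simp
    linarith
  have := aux_orbit_dense_of_commute T A hA (by intro y; simp [hAy]) x hx
  exact this

/-- Return classes modulo `p`. -/
def auxF (T : E →L[ℝ] E) (p : ℕ) (y z : E) : Set (ZMod p) :=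
  {g | z ∈ closure {w | ∃ n : ℕ, (n : ZMod p) = g ∧ T^[n] y = w}}

omit [IsTopologicalAddGroup E] [ContinuousSMul ℝ E] [LocallyConvexSpace ℝ E] in
theorem auxF_add (T : E →L[ℝ] E) (p : ℕ) (y z w : E) (g h : ZMod p) (hg : g ∈ auxF T p y z)
    (hh : h ∈ auxF T p z w) : g + h ∈ auxF T p y w := by
  simp only [auxF, Set.mem_ofPred_eq, mem_closure_iff] at *
  intro U hU hw
  obtain ⟨_, hzU, n, rfl, rfl⟩ := hh U hU hw
  obtain ⟨_, hyU, m, rfl, rfl⟩ := hg (T^[n] ⁻¹' U) (hU.preimage (T.continuous.iterate n)) hzU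
  exact ⟨_, hyU, n + m, by push_cast; ring, Function.iterate_add_apply _ _ _ _⟩

omit [IsTopologicalAddGroup E] [ContinuousSMul ℝ E] [LocallyConvexSpace ℝ E] in
theorem auxF_nonempty (T : E →L[ℝ] E) (p : ℕ) [NeZero p] (y z : E)
    (hy : Dense (Set.range fun n : ℕ => T^[n] y)) : ∃ g, g ∈ auxF T p y z := by
  have hcl : IsClosed (⋃ g : ZMod p, closure {w | ∃ n : ℕ, (n : ZMod p) = g ∧ T^[n] y = w}) :=
    isClosed_iUnion_of_finite fun _ => isClosed_closure
  have hsub : (Set.range fun n : ℕ => T^[n] y) ⊆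
      ⋃ g : ZMod p, closure {w | ∃ n : ℕ, (n : ZMod p) = g ∧ T^[n] y = w} := by
    rintro _ ⟨n, rfl⟩
    exact Set.mem_iUnion.2 ⟨n, subset_closure ⟨n, rfl, rfl⟩⟩
  obtain ⟨g, hg⟩ := Set.mem_iUnion.1 (closure_minimal hsub hcl (hy z))
  exact ⟨g, hg⟩

theorem aux_ansari [T1Space E] [Nontrivial E] (T : E →L[ℝ] E) (x : E)
    (hx : Dense (Set.range fun n : ℕ => T^[n] x)) (p : ℕ) (hp : 1 ≤ p) :
    Dense (Set.range fun n : ℕ => (T^[p])^[n] x) := by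
  haveI : NeZero p := ⟨by omega⟩
  have hmul : ∀ g ∈ auxF T p x x, ∀ n : ℕ, ((n + 1 : ℕ) : ZMod p) * g ∈ auxF T p x x := by
    intro g hg n
    induction n with
    | zero => simpa using hg
    | succ n ih =>
      have := auxF_add T p x x x _ _ ih hg
      convert this using 1
      push_cast
      ring
  have hzero : (0 : ZMod p) ∈ auxF T p x x := by
    obtain ⟨g, hg⟩ := auxF_nonempty T p x x hx
    have := hmul g hg (p - 1)
    rw [Nat.sub_add_cancel hp] at this
    simpa using this
  have hneg : ∀ g ∈ auxF T p x x, -g ∈ auxF T p x x := by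
    intro g hg
    by_cases hp1 : p = 1
    · subst hp1
      rw [Subsingleton.elim (-g) g]
      exact hg
    have := hmul g hg (p - 2)
    have h2 : ((p - 2 + 1 : ℕ) : ZMod p) = -1 := by
      have h3 : ((p - 2 + 1 + 1 : ℕ) : ZMod p) = 0 := by
        rw [show p - 2 + 1 + 1 = p by omega]; simp
      rw [Nat.cast_add_one (p - 2 + 1)] at h3
      exact eq_neg_of_add_eq_zero_left h3
    rw [h2] at this
    simpa using this
  let γ : ℝ → E := fun t => (1 - t) • x + t • T x
  have hγ : Continuous γ := by fun_prop
  let C : Set (ZMod p) → Set ℝ := fun G => ⋃ g ∈ G, {t | g ∈ auxF T p x (γ t)}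
  have hC : ∀ G, IsClosed (C G) := by
    intro G
    refine (Set.toFinite G).isClosed_biUnion fun g _ => ?_
    exact isClosed_closure.preimage hγ
  have hmemC : ∀ G t, t ∈ C G ↔ ∃ g ∈ G, g ∈ auxF T p x (γ t) := by
    intro G t
    simp [C]
  have hone : (1 : ZMod p) ∈ auxF T p x x := by
    by_contra hn1
    have hpre : IsPreconnected (Set.Icc (0 : ℝ) 1) := isPreconnected_Icc
    rw [isPreconnected_closed_iff] at hpre
    obtain ⟨t, ht, htA, htB⟩ := hpre (C (auxF T p x x)) (C (auxF T p x x)ᶜ) (hC _) (hC _) (by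
        intro t ht
        obtain ⟨g, hg⟩ := auxF_nonempty T p x (γ t) hx
        by_cases hgH : g ∈ auxF T p x x
        · exact Or.inl ((hmemC _ _).2 ⟨g, hgH, hg⟩)
        · exact Or.inr ((hmemC _ _).2 ⟨g, hgH, hg⟩))
      ⟨0, by simp, (hmemC _ _).2 ⟨0, hzero, by simpa [γ] using hzero⟩⟩
      ⟨1, by simp, (hmemC _ _).2 ⟨1, hn1, by
        have : T x ∈ closure {w | ∃ n : ℕ, (n : ZMod p) = 1 ∧ T^[n] x = w} :=
          subset_closure ⟨1, by simp, rfl⟩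
        simpa [γ, auxF] using this⟩⟩
    obtain ⟨g, hgH, hg⟩ := (hmemC _ _).1 htA
    obtain ⟨h, hhH, hh⟩ := (hmemC _ _).1 htB
    obtain ⟨k, hk⟩ := auxF_nonempty T p (γ t) x (aux_segment T x hx t ht.1 ht.2)
    have h1 := auxF_add T p _ _ _ _ _ hg hk
    have h2 := auxF_add T p _ _ _ _ _ hh hk
    apply hhH
    have h3 := auxF_add T p _ _ _ _ _ (auxF_add T p _ _ _ _ _ h2 (hneg _ h1)) hgH
    convert h3 using 1
    ring
  have hall : ∀ g : ZMod p, g ∈ auxF T p x x := by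
    intro g
    by_cases hg : g = 0
    · rw [hg]; exact hzero
    have hv : g.val ≠ 0 := by rwa [Ne, ZMod.val_eq_zero]
    have := hmul 1 hone (g.val - 1)
    rw [Nat.sub_add_cancel (by omega)] at this
    simpa using this
  intro z
  obtain ⟨g, hg⟩ := auxF_nonempty T p x z hx
  have h0 := auxF_add T p _ _ _ _ _ (hall (-g)) hg
  rw [neg_add_cancel] at h0
  refine closure_mono ?_ h0
  rintro _ ⟨n, hn, rfl⟩
  obtain ⟨k, rfl⟩ := (ZMod.natCast_eq_zero_iff n p).1 hn
  exact ⟨k, by simp only [Function.iterate_mul]⟩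

omit [IsTopologicalAddGroup E] [ContinuousSMul ℝ E] [LocallyConvexSpace ℝ E] in
theorem aux_denseRange_iter (T : E →L[ℝ] E) (h : DenseRange T) (n : ℕ) : DenseRange T^[n] := by
  induction n with
  | zero => exact Function.surjective_id.denseRange
  | succ n ih => rw [Function.iterate_succ']; exact h.comp ih T.continuous

theorem aux_topTrans [T1Space E] [Nontrivial E] (T : E →L[ℝ] E)
    (h : HypercyclicMap T) : TopTrans T := by
  obtain ⟨x, hx⟩ := h
  intro U V hU hV hUn hVn
  obtain ⟨_, hxU, n, rfl⟩ := hx.inter_open_nonempty U hU hUn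
  have hd := aux_denseRange_iter T (aux_denseRange_self T x hx) n
  have hd2 := hd.dense_image (T.continuous.iterate n) hx
  obtain ⟨_, hyV, _, ⟨m, rfl⟩, rfl⟩ := hd2.inter_open_nonempty V hV hVn
  refine ⟨m, T^[n] x, hxU, ?_⟩
  have : T^[m] (T^[n] x) = T^[n] (T^[m] x) := by
    rw [← Function.iterate_add_apply, ← Function.iterate_add_apply, add_comm]
  rw [this]
  exact hyV

theorem aux_birkhoff {Z : Type*} [TopologicalSpace Z] [SecondCountableTopology Z] [BaireSpace Z]
    [Nonempty Z] (f : Z → Z) (hf : Continuous f) (h : TopTrans f) : HypercyclicMap f := by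
  have hb := TopologicalSpace.isBasis_countableBasis Z
  have hd : Dense (⋂ V ∈ TopologicalSpace.countableBasis Z, ⋃ n : ℕ, f^[n] ⁻¹' V) := by
    refine dense_biInter_of_isOpen (fun V hV => ?_) (TopologicalSpace.countable_countableBasis Z)
      (fun V hV => ?_)
    · exact isOpen_iUnion fun n => (hb.isOpen hV).preimage (hf.iterate n)
    · rw [dense_iff_inter_open]
      intro U hU hUn
      obtain ⟨n, x, hxU, hxV⟩ := h U V hU (hb.isOpen hV) hUn
        (TopologicalSpace.nonempty_of_mem_countableBasis hV)
      exact ⟨x, hxU, Set.mem_iUnion.2 ⟨n, hxV⟩⟩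
  obtain ⟨x, hx⟩ := hd.nonempty
  refine ⟨x, hb.dense_iff.2 ?_⟩
  intro V hV _
  obtain ⟨n, hn⟩ := Set.mem_iUnion.1 (Set.mem_iInter₂.1 hx V hV)
  exact ⟨_, hn, n, rfl⟩

theorem aux_prod_iter {X Y : Type*} (T : X → X) (S : Y → Y) (n : ℕ) :
    (prodMap' T S)^[n] = prodMap' T^[n] S^[n] := by
  induction n with
  | zero => rfl
  | succ n ih =>
    rw [Function.iterate_succ', ih, Function.iterate_succ', Function.iterate_succ']
    rfl

end AnsariAux

theorem FrechetOp.aux_csmul (S : FrechetOp) : ContinuousSMul ℝ S.X := by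
  letI := S.instField
  exact IsScalarTower.continuousSMul S.𝕜

theorem FrechetOp.aux_lin (S : FrechetOp) : ∃ L : S.X →L[ℝ] S.X, ⇑L = S.T := by
  letI := S.instField
  refine ⟨⟨⟨⟨S.T, S.linear.map_add⟩, ?_⟩, S.cont⟩, rfl⟩
  intro r x
  have h : ∀ y : S.X, r • y = (r • (1 : S.𝕜)) • y := by
    intro y; rw [smul_assoc, one_smul]
  simp only [RingHom.id_apply]
  rw [h, h]
  exact S.linear.map_smul _ _

theorem FrechetOp.aux_nontrivial (S : FrechetOp) : Nontrivial S.X := by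
  letI := S.instField
  by_contra h
  rw [not_nontrivial_iff_subsingleton] at h
  exact S.infDim inferInstance

theorem FrechetOp.aux_unif (S : FrechetOp) : (uniformity S.X).IsCountablyGenerated :=
  IsUniformAddGroup.uniformity_countably_generated

/-- The power of an operator. -/
def FrechetOp.auxPow (S : FrechetOp) (p : ℕ) : FrechetOp :=
  letI := S.instField
  { 𝕜 := S.𝕜
    X := S.X
    infDim := S.infDim
    T := S.T^[p]
    linear := by
      induction p with
      | zero => exact ⟨fun _ _ => rfl, fun _ _ => rfl⟩
      | succ n ih =>
        refine ⟨fun a b => ?_, fun c a => ?_⟩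
        · simp only [Function.iterate_succ_apply', ih.map_add, S.linear.map_add]
        · simp only [Function.iterate_succ_apply', ih.map_smul, S.linear.map_smul]
    cont := S.cont.iterate p }

theorem FrechetOp.aux_pow_hypercyclic (S : FrechetOp) (h : S.Hypercyclic) (p : ℕ) (hp : 1 ≤ p) :
    (S.auxPow p).Hypercyclic := by
  haveI := S.aux_csmul
  haveI := S.aux_nontrivial
  obtain ⟨L, hL⟩ := S.aux_lin
  obtain ⟨x, hx⟩ := h
  rw [← hL] at hx
  refine ⟨x, ?_⟩
  have := aux_ansari L x hx p hp
  rw [hL] at this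
  exact this

theorem FrechetOp.aux_topTrans (S : FrechetOp) (h : S.Hypercyclic) : TopTrans S.T := by
  haveI := S.aux_csmul
  haveI := S.aux_nontrivial
  obtain ⟨L, hL⟩ := S.aux_lin
  have h' : HypercyclicMap L := by rw [hL]; exact h
  rw [← hL]
  exact _root_.aux_topTrans L h'

theorem FrechetOp.aux_denseRange (S : FrechetOp) (h : S.Hypercyclic) (n : ℕ) :
    DenseRange S.T^[n] := by
  haveI := S.aux_csmul
  haveI := S.aux_nontrivial
  obtain ⟨L, hL⟩ := S.aux_lin
  obtain ⟨x, hx⟩ := h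
  rw [← hL] at hx ⊢
  exact aux_denseRange_iter L (aux_denseRange_self L x hx) n

theorem FrechetOp.aux_chaotic (T S : FrechetOp) (hT : T.Hypercyclic)
    (hper : Dense {x : T.X | ∃ m : ℕ, 1 ≤ m ∧ T.T^[m] x = x}) (hS : S.Hypercyclic) :
    TopTrans (prodMap' T.T S.T) := by
  intro U V hU hV ⟨u, hu⟩ ⟨v, hv⟩
  obtain ⟨U1, U2, hU1, hU2, hu1, hu2, hUU⟩ := isOpen_prod_iff.1 hU u.1 u.2 hu
  obtain ⟨V1, V2, hV1, hV2, hv1, hv2, hVV⟩ := isOpen_prod_iff.1 hV v.1 v.2 hv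
  obtain ⟨n, y, hyU, hyV⟩ := T.aux_topTrans hT U1 V1 hU1 hV1 ⟨_, hu1⟩ ⟨_, hv1⟩
  obtain ⟨z, ⟨hzU, hzV⟩, m, hm, hz⟩ := hper.inter_open_nonempty (U1 ∩ T.T^[n] ⁻¹' V1)
    (hU1.inter (hV1.preimage (T.cont.iterate n))) ⟨y, hyU, hyV⟩
  obtain ⟨_, hw, w, rfl⟩ := (S.aux_denseRange hS n).inter_open_nonempty V2 hV2 ⟨_, hv2⟩
  have htr : TopTrans S.T^[m] := (S.auxPow m).aux_topTrans (S.aux_pow_hypercyclic hS m hm)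
  obtain ⟨j, a, haU, haV⟩ := htr U2 (S.T^[n] ⁻¹' V2) hU2 (hV2.preimage (S.cont.iterate n)) ⟨_, hu2⟩ ⟨w, hw⟩
  refine ⟨n + m * j, (z, a), hUU ⟨hzU, haU⟩, hVV ?_⟩
  rw [aux_prod_iter]
  constructor
  · change T.T^[n + m * j] z ∈ V1
    rw [Function.iterate_add_apply, Function.iterate_mul, Function.iterate_fixed hz]
    exact hzV
  · change S.T^[n + m * j] a ∈ V2
    rw [Function.iterate_add_apply, Function.iterate_mul]
    exact haV

/-- (1) Every chaotic operator (hypercyclic with dense periodic points)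
is mildly mixing. (2) If some power `T^p`, `p ≥ 1`, of an operator is mildly mixing,
then so is `T`. -/
theorem mildlyMixing_of_chaotic_and_of_power (T : FrechetOp) :
    (T.Hypercyclic ∧ Dense {x : T.X | ∃ m : ℕ, 1 ≤ m ∧ T.T^[m] x = x} →
      MildlyMixing T.T) ∧
    (∀ p : ℕ, 1 ≤ p → MildlyMixing (T.T^[p]) → MildlyMixing T.T) := by
  constructor
  · rintro ⟨hT, hper⟩ S hS
    haveI := T.aux_unif
    haveI := S.aux_unif
    haveI : SecondCountableTopology T.X := UniformSpace.secondCountable_of_separable T.X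
    haveI : SecondCountableTopology S.X := UniformSpace.secondCountable_of_separable S.X
    exact aux_birkhoff _ ((T.cont.comp continuous_fst).prodMk (S.cont.comp continuous_snd))
      (T.aux_chaotic S hT hper hS)
  · intro p hp hmm S hS
    obtain ⟨x, hx⟩ := hmm (S.auxPow p) (S.aux_pow_hypercyclic hS p hp)
    refine ⟨x, hx.mono ?_⟩
    rintro _ ⟨n, rfl⟩
    refine ⟨p * n, ?_⟩
    simp only [Function.iterate_mul]
    rw [aux_prod_iter T.T S.T p]
    rfl
end

section
/- Let F be a full Furstenberg family, let F ⊆ ℕ, and let X = c₀(ℤ) or ℓ^p(ℤ) with 1 ≤ p < ∞. Then F ∈ F̃ if and only if there exists a bounded sequence w = (w_n)_{n∈ℤ} of positive real numbers with (1/w_n)_{n∈ℤ} also bounded (so that the bilateral weighted backward shift B_w : X → X, (B_w x)_n = w_{n+1} x_{n+1}, is an invertible operator on X) such that B_w is F-mixing and there is a nonempty open subset W of X with N_{B_w}(W,W) ⊆ F ∪ {0}. -/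
open Set Topology Function Filter
open scoped ENNReal

/-! ### Full families -/

theorem full_diff_finite {F : Set (Set ℕ)} (hF : IsFamily F) (hfull : FullFamily F)
    {A G : Set ℕ} (hA : A ∈ F) (hG : G.Finite) : A \ G ∈ F := by
  by_contra h
  have hB : (A \ G)ᶜ ∈ dualFam F := by
    intro C hC
    by_contra hne
    rw [Set.not_nonempty_iff_eq_empty] at hne
    apply h
    refine hF.2.1 hC ?_
    intro x hx
    by_contra hx'
    have : x ∈ (A \ G)ᶜ ∩ C := ⟨hx', hx⟩
    rw [hne] at this
    exact this
  refine hfull A hA _ hB (hG.subset ?_)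
  rintro x ⟨hx, hx'⟩
  by_contra hxG
  exact hx' ⟨hx, hxG⟩

theorem prodMap'_iterate {X : Type*} (T : X → X) (n : ℕ) (q : X × X) :
    (prodMap' T T)^[n] q = (T^[n] q.1, T^[n] q.2) := by
  induction n generalizing q with
  | zero => rfl
  | succ n ih => simp [Function.iterate_succ, ih, prodMap']

theorem nset_prod_subset {X : Type*} (T : X → X) (U V U' V' : Set X) :
    nset (prodMap' T T) (U ×ˢ U') (V ×ˢ V') ⊆ nset T U V ∩ nset T U' V' := by
  rintro n ⟨q, hq, hn⟩
  rw [prodMap'_iterate] at hn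
  exact ⟨⟨q.1, hq.1, hn.1⟩, ⟨q.2, hq.2, hn.2⟩⟩

/-- Furstenberg's intersection lemma. -/
theorem furst_inter {X : Type*} [TopologicalSpace X] {T : X → X} (hT : Continuous T)
    {F : Set (Set ℕ)} (hF : IsFamily F) (hmix : FMix T F)
    {U V U' V' : Set X} (hU : IsOpen U) (hV : IsOpen V) (hU' : IsOpen U') (hV' : IsOpen V')
    (nU : U.Nonempty) (nV : V.Nonempty) (nU' : U'.Nonempty) (nV' : V'.Nonempty) :
    ∃ P Q : Set X, IsOpen P ∧ IsOpen Q ∧ P.Nonempty ∧ Q.Nonempty ∧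
      nset T P Q ⊆ nset T U V ∩ nset T U' V' := by
  have h1 := hmix (U ×ˢ V) (U' ×ˢ V') (hU.prod hV) (hU'.prod hV') (nU.prod nV) (nU'.prod nV')
  have h2 := hF.2.1 h1 (nset_prod_subset T U U' V V')
  have h3 : (nset T U U' ∩ nset T V V').Nonempty := by
    by_contra h
    rw [Set.not_nonempty_iff_eq_empty] at h
    rw [h] at h2
    exact hF.2.2 h2
  obtain ⟨n, ⟨x, hx, hx'⟩, ⟨y, hy, hy'⟩⟩ := h3
  refine ⟨U ∩ T^[n] ⁻¹' U', V ∩ T^[n] ⁻¹' V', hU.inter (hU'.preimage (hT.iterate n)),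
    hV.inter (hV'.preimage (hT.iterate n)), ⟨x, hx, hx'⟩, ⟨y, hy, hy'⟩, ?_⟩
  rintro m ⟨z, ⟨hz, hz'⟩, ⟨hm, hm'⟩⟩
  refine ⟨⟨z, hz, hm⟩, ⟨T^[n] z, hz', ?_⟩⟩
  rw [Set.mem_preimage, ← Function.iterate_add_apply, add_comm, Function.iterate_add_apply] at hm'
  exact hm'

theorem tilde_of_mixing {X : Type*} [TopologicalSpace X] {T : X → X} (hT : Continuous T)
    {F : Set (Set ℕ)} (hF : IsFamily F) (hfull : FullFamily F) (hmix : FMix T F)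
    {A : Set ℕ} {W : Set X} (hW : IsOpen W) (nW : W.Nonempty)
    (hsub : nset T W W ⊆ A ∪ {0}) : A ∈ tildeFam F := by
  have htr : ∀ U V : Set X, IsOpen U → IsOpen V → U.Nonempty → V.Nonempty → nset T U V ∈ F := by
    intro U V hU hV nU nV
    exact hF.2.1 (hmix (U ×ˢ U) (V ×ˢ V) (hU.prod hU) (hV.prod hV) (nU.prod nU) (nV.prod nV))
      ((nset_prod_subset T U V U V).trans Set.inter_subset_left)
  have hAF : A ∈ F := by
    refine hF.2.1 (full_diff_finite hF hfull (htr W W hW hW nW nW) (Set.finite_singleton 0)) ?_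
    rintro n ⟨hn, hn0⟩
    rcases hsub hn with h | h
    · exact h
    · exact absurd h hn0
  have hpre : ∀ i : ℕ, (T^[i] ⁻¹' W).Nonempty := by
    intro i
    have h := full_diff_finite hF hfull (htr W W hW hW nW nW) (Set.finite_lt_nat i)
    have hne : (nset T W W \ {n | n < i}).Nonempty := by
      by_contra h'
      rw [Set.not_nonempty_iff_eq_empty] at h'
      rw [h'] at h
      exact hF.2.2 h
    obtain ⟨n, ⟨x, hx, hx'⟩, hn⟩ := hne
    have hn : i ≤ n := by simpa using hn
    refine ⟨T^[n - i] x, ?_⟩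
    rw [Set.mem_preimage, ← Function.iterate_add_apply, Nat.add_sub_cancel' hn]
    exact hx'
  have key : ∀ k : ℕ, ∃ P Q : Set X, IsOpen P ∧ IsOpen Q ∧ P.Nonempty ∧ Q.Nonempty ∧
      ∀ i ≤ k, nset T P Q ⊆ nset T (T^[i] ⁻¹' W) W ∩ nset T W (T^[i] ⁻¹' W) := by
    intro k
    induction k with
    | zero =>
      refine ⟨W, W, hW, hW, nW, nW, ?_⟩
      intro i hi
      obtain rfl : i = 0 := by omega
      simp
    | succ k ih =>
      obtain ⟨P, Q, hP, hQ, nP, nQ, h⟩ := ih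
      have hp := hW.preimage (hT.iterate (k + 1))
      obtain ⟨P1, Q1, hP1, hQ1, nP1, nQ1, h1⟩ :=
        furst_inter hT hF hmix hp hW hW hp (hpre _) nW nW (hpre _)
      obtain ⟨P2, Q2, hP2, hQ2, nP2, nQ2, h2⟩ :=
        furst_inter hT hF hmix hP hQ hP1 hQ1 nP nQ nP1 nQ1
      refine ⟨P2, Q2, hP2, hQ2, nP2, nQ2, ?_⟩
      intro i hi n hn
      rcases Nat.lt_or_ge i (k + 1) with hik | hik
      · exact h i (by omega) (h2 hn).1
      · obtain rfl : i = k + 1 := by omega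
        exact h1 (h2 hn).2
  refine ⟨hAF, fun k => ?_⟩
  obtain ⟨P, Q, hP, hQ, nP, nQ, h⟩ := key k
  refine hF.2.1 (full_diff_finite hF hfull (htr P Q hP hQ nP nQ) (Set.finite_le_nat k)) ?_
  rintro n ⟨hn, hnk⟩
  have hnk : k < n := by simpa using hnk
  intro i hi
  have hmem : ∀ m : ℕ, m ∈ nset T W W → m ≠ 0 → m ∈ A := by
    intro m hm hm0
    rcases hsub hm with h | h
    · exact h
    · exact absurd h hm0
  rw [abs_le] at hi
  rcases le_total 0 i with h0 | h0
  · obtain ⟨j, rfl⟩ := Int.eq_ofNat_of_zero_le h0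
    obtain ⟨x, hx, hx'⟩ := (h j (by omega) hn).1
    refine ⟨n - j, hmem _ ⟨T^[j] x, hx, ?_⟩ (by omega), by omega⟩
    rw [← Function.iterate_add_apply, Nat.sub_add_cancel (by omega)]
    exact hx'
  · obtain ⟨j, hj⟩ := Int.eq_ofNat_of_zero_le (show 0 ≤ -i by omega)
    obtain ⟨x, hx, hx'⟩ := (h j (by omega) hn).2
    refine ⟨n + j, hmem _ ⟨x, hx, ?_⟩ (by omega), by omega⟩
    rw [add_comm, Function.iterate_add_apply]
    exact (hx')

/-! ### The weights -/

/-- The symmetric bad set of integers. -/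
def badSet (A : Set ℕ) : Set ℤ := {m : ℤ | m.natAbs ∉ A ∨ m = 0}

/-- Distance to the bad set. -/
noncomputable def hgt (A : Set ℕ) (n : ℤ) : ℝ := Metric.infDist n (badSet A)

/-- The partial products of the weights. -/
noncomputable def bprod (A : Set ℕ) (n : ℤ) : ℝ := (2 : ℝ) ^ (hgt A n)

/-- The weights. -/
noncomputable def wgt (A : Set ℕ) (n : ℤ) : ℝ := bprod A n / bprod A (n - 1)

theorem badSet_nonempty (A : Set ℕ) : (badSet A).Nonempty := ⟨0, Or.inr rfl⟩

theorem hgt_le_add (A : Set ℕ) (m n : ℤ) : hgt A m ≤ hgt A n + |(m : ℝ) - n| := by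
  have := Metric.infDist_le_infDist_add_dist (s := badSet A) (x := m) (y := n)
  rwa [Int.dist_eq] at this

theorem hgt_neg_le (A : Set ℕ) (n : ℤ) : hgt A n ≤ hgt A (-n) := by
  refine (Metric.le_infDist (badSet_nonempty A)).2 ?_
  intro y hy
  have hy' : -y ∈ badSet A := by
    rcases hy with h | h
    · left; simpa using h
    · right; simp [h]
  have := Metric.infDist_le_dist_of_mem (x := n) hy'
  refine this.trans (le_of_eq ?_)
  rw [Int.dist_eq, Int.dist_eq, ← abs_neg]
  push_cast
  ring_nf

theorem hgt_neg (A : Set ℕ) (n : ℤ) : hgt A (-n) = hgt A n :=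
  le_antisymm (by simpa using hgt_neg_le A (-n)) (hgt_neg_le A n)

theorem bprod_pos (A : Set ℕ) (n : ℤ) : 0 < bprod A n := Real.rpow_pos_of_pos two_pos _

theorem bprod_zero (A : Set ℕ) : bprod A 0 = 1 := by
  have : hgt A 0 = 0 := Metric.infDist_zero_of_mem (Or.inr rfl)
  simp [bprod, this]

theorem bprod_eq_one (A : Set ℕ) (n : ℕ) (hn : n ∉ A) : bprod A n = 1 := by
  have : hgt A n = 0 := Metric.infDist_zero_of_mem (Or.inl (by simpa using hn))
  simp [bprod, this]

theorem wgt_pos (A : Set ℕ) (n : ℤ) : 0 < wgt A n := div_pos (bprod_pos _ _) (bprod_pos _ _)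

theorem wgt_le (A : Set ℕ) (n : ℤ) : wgt A n ≤ 2 := by
  rw [wgt, bprod, bprod, ← Real.rpow_sub two_pos]
  have h := hgt_le_add A n (n - 1)
  have e : |(n : ℝ) - ((n - 1 : ℤ) : ℝ)| = 1 := by push_cast; simp
  calc (2 : ℝ) ^ (hgt A n - hgt A (n - 1)) ≤ 2 ^ (1 : ℝ) :=
        Real.rpow_le_rpow_of_exponent_le one_le_two (by linarith)
    _ = 2 := by simp

theorem le_wgt (A : Set ℕ) (n : ℤ) : 1 / 2 ≤ wgt A n := by
  rw [wgt, bprod, bprod, ← Real.rpow_sub two_pos]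
  have h := hgt_le_add A (n - 1) n
  have e : |((n - 1 : ℤ) : ℝ) - (n : ℝ)| = 1 := by push_cast; simp
  calc (1 / 2 : ℝ) = 2 ^ (-1 : ℝ) := by rw [Real.rpow_neg_one]; norm_num
    _ ≤ _ := Real.rpow_le_rpow_of_exponent_le one_le_two (by linarith)

theorem tendsto_bprod (A : Set ℕ) (j : ℤ) :
    Tendsto (fun n : ℤ => bprod A (j + n)) (comap (hgt A) atTop) atTop := by
  have h1 : Tendsto (fun n : ℤ => hgt A n - |(j : ℝ)|) (comap (hgt A) atTop) atTop :=
    tendsto_atTop_add_const_right _ _ tendsto_comap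
  have h2 : Tendsto (fun n : ℤ => hgt A (j + n)) (comap (hgt A) atTop) atTop := by
    refine tendsto_atTop_mono (fun n => ?_) h1
    have h := hgt_le_add A n (j + n)
    have e : |(n : ℝ) - ((j + n : ℤ) : ℝ)| = |(j : ℝ)| := by push_cast; simp
    linarith
  exact (tendsto_rpow_atTop_of_base_gt_one 2 one_lt_two).comp h2

theorem mem_of_eventually {F : Set (Set ℕ)} (hF : IsFamily F) (hfull : FullFamily F)
    {A : Set ℕ} (hA : A ∈ tildeFam F) {N : Set ℕ}
    (hN : ∀ᶠ n : ℕ in comap (fun n : ℕ => hgt A n) atTop, n ∈ N) : N ∈ F := by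
  rw [(atTop_basis.comap _).eventually_iff] at hN
  obtain ⟨M, -, hM⟩ := hN
  obtain ⟨k, hk⟩ := exists_nat_ge M
  refine hF.2.1 (full_diff_finite hF hfull (hA.2 k) (Set.finite_le_nat k)) ?_
  rintro n ⟨hn, hnk⟩
  have hnk : k < n := by simpa using hnk
  refine hM (show M ≤ hgt A n from hk.trans ?_)
  refine (Metric.le_infDist (badSet_nonempty A)).2 ?_
  intro y hy
  by_contra hlt
  rw [not_le, Int.dist_eq] at hlt
  have hlt' : |(n : ℤ) - y| < k := by exact_mod_cast hlt
  obtain ⟨m, hmA, hm⟩ := hn ((n : ℤ) - y) hlt'.le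
  have hy1 : y = m := by omega
  rw [abs_lt] at hlt'
  rcases hy with h | h
  · apply h; rw [hy1]; simpa using hmA
  · omega

/-! ### Abstract weighted shifts -/

section abs
variable {𝕜 : Type} [RCLike 𝕜] {X : Type*} [NormedAddCommGroup X] [NormedSpace 𝕜 X]

/-- Shifted finite sums. -/
noncomputable def ush (A : Set ℕ) (e : ℤ → X) (s : Finset ℤ) (a : ℤ → 𝕜) (n : ℤ) : X :=
  ∑ j ∈ s, (a j * ((bprod A j / bprod A (j + n) : ℝ) : 𝕜)) • e (j + n)

theorem ush_zero (A : Set ℕ) (e : ℤ → X) (s : Finset ℤ) (a : ℤ → 𝕜) :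
    ush A e s a 0 = ∑ j ∈ s, a j • e j := by
  simp [ush, div_self (bprod_pos A _).ne']

theorem ush_tendsto (A : Set ℕ) (e : ℤ → X) (he : ∀ j, ‖e j‖ ≤ 1) (s : Finset ℤ) (a : ℤ → 𝕜) :
    Tendsto (ush A e s a) (comap (hgt A) atTop) (𝓝 0) := by
  have : Tendsto (ush A e s a) (comap (hgt A) atTop) (𝓝 (∑ j ∈ s, (0 : X))) := by
    refine tendsto_finsetSum _ fun j _ => ?_
    have h1 : Tendsto (fun n : ℤ => ‖a j‖ * (bprod A j / bprod A (j + n)))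
        (comap (hgt A) atTop) (𝓝 (‖a j‖ * 0)) :=
      ((tendsto_bprod A j).const_div_atTop _).const_mul _
    rw [mul_zero] at h1
    refine squeeze_zero_norm (fun n => ?_) h1
    have hp : 0 ≤ bprod A j / bprod A (j + n) := (div_pos (bprod_pos A _) (bprod_pos A _)).le
    rw [norm_smul, norm_mul, RCLike.norm_ofReal, abs_of_nonneg hp]
    exact mul_le_of_le_one_right (mul_nonneg (norm_nonneg _) hp) (he _)
  simpa using this

theorem B_ush (A : Set ℕ) (e : ℤ → X) (B : X →L[𝕜] X)
    (hBe : ∀ j, B (e j) = ((wgt A j : ℝ) : 𝕜) • e (j - 1)) (s : Finset ℤ) (a : ℤ → 𝕜) (n : ℤ) :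
    B (ush A e s a n) = ush A e s a (n - 1) := by
  rw [ush, ush, map_sum]
  refine Finset.sum_congr rfl fun j _ => ?_
  rw [map_smul, hBe, smul_smul, mul_assoc, ← RCLike.ofReal_mul, wgt, add_sub_assoc]
  congr 3
  have h1 := (bprod_pos A (j + n)).ne'
  have h2 := (bprod_pos A (j + (n - 1))).ne'
  field_simp

theorem B_iter_ush (A : Set ℕ) (e : ℤ → X) (B : X →L[𝕜] X)
    (hBe : ∀ j, B (e j) = ((wgt A j : ℝ) : 𝕜) • e (j - 1)) (s : Finset ℤ) (a : ℤ → 𝕜)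
    (m : ℕ) (n : ℤ) :
    B^[m] (ush A e s a n) = ush A e s a (n - m) := by
  induction m generalizing n with
  | zero => simp
  | succ m ih =>
    rw [Function.iterate_succ_apply, B_ush A e B hBe, ih]
    congr 1
    push_cast
    ring

theorem iter_add (B : X →L[𝕜] X) (n : ℕ) (x y : X) : B^[n] (x + y) = B^[n] x + B^[n] y := by
  induction n generalizing x y with
  | zero => rfl
  | succ n ih => simp [Function.iterate_succ_apply, ih]

theorem eventually_nset (A : Set ℕ) (e : ℤ → X) (he : ∀ j, ‖e j‖ ≤ 1) (B : X →L[𝕜] X)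
    (hBe : ∀ j, B (e j) = ((wgt A j : ℝ) : 𝕜) • e (j - 1))
    (hd : ∀ x : X, ∀ ε > 0, ∃ (s : Finset ℤ) (a : ℤ → 𝕜), ‖x - ∑ j ∈ s, a j • e j‖ < ε)
    {U V : Set X} (hU : IsOpen U) (hV : IsOpen V) (nU : U.Nonempty) (nV : V.Nonempty) :
    ∀ᶠ n : ℕ in comap (fun n : ℕ => hgt A n) atTop, n ∈ nset B U V := by
  have hd' : ∀ O : Set X, IsOpen O → O.Nonempty →
      ∃ (s : Finset ℤ) (a : ℤ → 𝕜), ush A e s a 0 ∈ O := by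
    rintro O hO ⟨x, hx⟩
    obtain ⟨ε, hε, hb⟩ := Metric.isOpen_iff.1 hO x hx
    obtain ⟨s, a, h⟩ := hd x ε hε
    refine ⟨s, a, hb ?_⟩
    rw [ush_zero, Metric.mem_ball, dist_comm, dist_eq_norm]
    exact h
  obtain ⟨s, a, hx⟩ := hd' U hU nU
  obtain ⟨t, c, hy⟩ := hd' V hV nV
  have t1 : Tendsto (fun n : ℕ => (n : ℤ)) (comap (fun n : ℕ => hgt A n) atTop)
      (comap (hgt A) atTop) := by
    rw [tendsto_comap_iff]; exact tendsto_comap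
  have t2 : Tendsto (fun n : ℕ => (0 - (n : ℤ))) (comap (fun n : ℕ => hgt A n) atTop)
      (comap (hgt A) atTop) := by
    rw [tendsto_comap_iff]
    have : (hgt A ∘ fun n : ℕ => (0 - (n : ℤ))) = fun n : ℕ => hgt A n := by
      funext n
      simp [hgt_neg]
    rw [this]; exact tendsto_comap
  have u1 := ((ush_tendsto A e he t c).comp t1).const_add (ush A e s a 0)
  have u2 := ((ush_tendsto A e he s a).comp t2).add_const (ush A e t c 0)
  rw [add_zero] at u1
  rw [zero_add] at u2
  filter_upwards [u1.eventually (hU.mem_nhds hx), u2.eventually (hV.mem_nhds hy)] with n h1 h2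
  refine ⟨_, h1, ?_⟩
  rw [iter_add, B_iter_ush A e B hBe]
  simp only [Function.comp]
  rw [B_iter_ush A e B hBe, sub_self]
  exact h2

theorem mixing_of_tilde {F : Set (Set ℕ)} (hF : IsFamily F) (hfull : FullFamily F)
    {A : Set ℕ} (hA : A ∈ tildeFam F) (e : ℤ → X) (he : ∀ j, ‖e j‖ ≤ 1) (B : X →L[𝕜] X)
    (hBe : ∀ j, B (e j) = ((wgt A j : ℝ) : 𝕜) • e (j - 1))
    (hd : ∀ x : X, ∀ ε > 0, ∃ (s : Finset ℤ) (a : ℤ → 𝕜), ‖x - ∑ j ∈ s, a j • e j‖ < ε) :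
    FMix B F := by
  rintro U V hU hV ⟨⟨u, u'⟩, hu⟩ ⟨⟨v, v'⟩, hv⟩
  obtain ⟨U1, U2, hU1, hU2, hu1, hu2, hUs⟩ := isOpen_prod_iff.1 hU u u' hu
  obtain ⟨V1, V2, hV1, hV2, hv1, hv2, hVs⟩ := isOpen_prod_iff.1 hV v v' hv
  apply mem_of_eventually hF hfull hA
  filter_upwards [eventually_nset A e he B hBe hd hU1 hV1 ⟨u, hu1⟩ ⟨v, hv1⟩,
    eventually_nset A e he B hBe hd hU2 hV2 ⟨u', hu2⟩ ⟨v', hv2⟩] with n h1 h2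
  obtain ⟨x, hx, hx'⟩ := h1
  obtain ⟨y, hy, hy'⟩ := h2
  refine ⟨(x, y), hUs ⟨hx, hy⟩, hVs ?_⟩
  rw [prodMap'_iterate]
  exact ⟨hx', hy'⟩

theorem window (A : Set ℕ) (c : ℤ → X → 𝕜) (hc : ∀ n x y, ‖c n x - c n y‖ ≤ ‖x - y‖)
    (x₀ : X) (h0 : c 0 x₀ = 1) (h1 : ∀ n, n ≠ 0 → c n x₀ = 0) (B : X → X)
    (hB : ∀ x n, c n (B x) = wgt A (n + 1) • c (n + 1) x) :
    ∃ W : Set X, IsOpen W ∧ W.Nonempty ∧ nset B W W ⊆ A ∪ {0} := by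
  have hit : ∀ (n : ℕ) (m : ℤ) (x : X),
      c m (B^[n] x) = (bprod A (m + n) / bprod A m) • c (m + n) x := by
    intro n
    induction n with
    | zero => intro m x; simp [div_self (bprod_pos A _).ne']
    | succ n ih =>
      intro m x
      rw [Function.iterate_succ_apply, ih, hB, smul_smul, wgt]
      have e1 : m + ((n + 1 : ℕ) : ℤ) = m + n + 1 := by push_cast; ring
      rw [e1, add_sub_cancel_right]
      congr 1
      have h1 := (bprod_pos A (m + n)).ne'
      field_simp
  refine ⟨Metric.ball x₀ (1 / 3), Metric.isOpen_ball, ⟨x₀, by simp⟩, ?_⟩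
  rintro n ⟨x, hx, hx'⟩
  by_contra hn
  simp only [Set.mem_union, Set.mem_singleton_iff, not_or] at hn
  rw [Metric.mem_ball, dist_eq_norm] at hx hx'
  have a1 := (hc 0 (B^[n] x) x₀).trans_lt hx'
  have a2 := (hc n x x₀).trans_lt hx
  rw [h1 n (by exact_mod_cast hn.2), sub_zero] at a2
  rw [hit, h0, zero_add, bprod_zero, bprod_eq_one A n hn.1, div_one, one_smul] at a1
  have a3 : ‖(1 : 𝕜)‖ ≤ ‖c n x‖ + ‖c n x - 1‖ := by
    have := norm_sub_le (c n x) (c n x - 1)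
    simpa using this
  rw [norm_one] at a3
  linarith

end abs

/-! ### Concrete shifts -/

section lpcase
variable (𝕜 : Type) [RCLike 𝕜] (p : ℝ≥0∞) [Fact (1 ≤ p)]

theorem exists_shift_lp (hp : p ≠ ∞) (A : Set ℕ) :
    ∃ B : lp (fun _ : ℤ => 𝕜) p →L[𝕜] lp (fun _ : ℤ => 𝕜) p,
      ∀ (x : lp (fun _ : ℤ => 𝕜) p) (n : ℤ), B x n = wgt A (n + 1) • x (n + 1) := by
  have hp1 : (1 : ℝ≥0∞) ≤ p := Fact.out
  have hpp : 0 < p.toReal := ENNReal.toReal_pos (by positivity) hp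
  have hterm : ∀ (x : lp (fun _ : ℤ => 𝕜) p) (n : ℤ),
      ‖wgt A (n + 1) • x (n + 1)‖ ^ p.toReal ≤ 2 ^ p.toReal * ‖x (n + 1)‖ ^ p.toReal := by
    intro x n
    rw [← Real.mul_rpow (by norm_num) (norm_nonneg _)]
    refine Real.rpow_le_rpow (norm_nonneg _) ?_ hpp.le
    rw [norm_smul, Real.norm_eq_abs, abs_of_pos (wgt_pos A _)]
    exact mul_le_mul_of_nonneg_right (wgt_le A _) (norm_nonneg _)
  have hs0 : ∀ (x : lp (fun _ : ℤ => 𝕜) p), Summable fun n : ℤ => ‖x (n + 1)‖ ^ p.toReal := by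
    intro x
    exact ((Equiv.addRight (1 : ℤ)).summable_iff).2 ((memℓp_gen_iff hpp).1 (lp.memℓp x))
  have hs : ∀ (x : lp (fun _ : ℤ => 𝕜) p),
      Summable fun n : ℤ => ‖wgt A (n + 1) • x (n + 1)‖ ^ p.toReal := by
    intro x
    exact Summable.of_nonneg_of_le (fun n => by positivity) (hterm x) ((hs0 x).mul_left _)
  have hmem : ∀ (x : lp (fun _ : ℤ => 𝕜) p),
      Memℓp (fun n : ℤ => (wgt A (n + 1) • x (n + 1) : 𝕜)) p := by
    intro x
    exact (memℓp_gen_iff hpp).2 (hs x)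
  let L : lp (fun _ : ℤ => 𝕜) p →ₗ[𝕜] lp (fun _ : ℤ => 𝕜) p :=
    { toFun := fun x => ⟨fun n : ℤ => (wgt A (n + 1) • x (n + 1) : 𝕜), hmem x⟩
      map_add' := by
        intro x y
        ext n
        change wgt A (n + 1) • (x (n + 1) + y (n + 1)) = _
        rw [smul_add]
        rfl
      map_smul' := by
        intro r x
        ext n
        change wgt A (n + 1) • (r • x (n + 1)) = r • (wgt A (n + 1) • x (n + 1))
        rw [smul_comm] }
  have hL : ∀ x n, L x n = wgt A (n + 1) • x (n + 1) := fun x n => rfl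
  refine ⟨L.mkContinuous 2 ?_, fun x n => rfl⟩
  intro x
  refine lp.norm_le_of_tsum_le hpp (by positivity) ?_
  rw [Real.mul_rpow (by norm_num) (norm_nonneg _), lp.norm_rpow_eq_tsum hpp]
  calc ∑' n, ‖L x n‖ ^ p.toReal ≤ ∑' n : ℤ, 2 ^ p.toReal * ‖x (n + 1)‖ ^ p.toReal :=
        (hs x).tsum_le_tsum (hterm x) ((hs0 x).mul_left _)
    _ = 2 ^ p.toReal * ∑' n : ℤ, ‖x (n + 1)‖ ^ p.toReal := tsum_mul_left
    _ = _ := by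
        congr 1
        exact (Equiv.addRight (1 : ℤ)).tsum_eq (fun n => ‖x n‖ ^ p.toReal)

theorem lp_case (hp : p ≠ ∞) {F : Set (Set ℕ)} (hF : IsFamily F) (hfull : FullFamily F)
    {A : Set ℕ} (hA : A ∈ tildeFam F) :
    ∃ (w : ℤ → ℝ) (B : lp (fun _ : ℤ => 𝕜) p →L[𝕜] lp (fun _ : ℤ => 𝕜) p),
          IsInvertibleWBSlp 𝕜 p w B ∧ FMix ⇑B F ∧
            ∃ W : Set (lp (fun _ : ℤ => 𝕜) p), IsOpen W ∧ W.Nonempty ∧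
              nset ⇑B W W ⊆ A ∪ {0} := by
  have hp1 : (1 : ℝ≥0∞) ≤ p := Fact.out
  have hp0 : 0 < p := lt_of_lt_of_le one_pos hp1
  obtain ⟨B, hB⟩ := exists_shift_lp 𝕜 p hp A
  have he : ∀ j n : ℤ, (lp.single p j (1 : 𝕜) : lp (fun _ : ℤ => 𝕜) p) n
      = if n = j then 1 else 0 := by
    intro j n
    rw [lp.single_apply, Pi.single_apply]
  refine ⟨wgt A, B, ⟨wgt_pos A, ⟨2, wgt_le A⟩, ⟨1 / 2, by norm_num, le_wgt A⟩, hB⟩, ?_, ?_⟩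
  · refine mixing_of_tilde hF hfull hA (fun j => lp.single p j (1 : 𝕜)) ?_ B ?_ ?_
    · intro j
      rw [lp.norm_single hp0]
      simp
    · intro j
      ext n
      rw [hB, he, lp.coeFn_smul, Pi.smul_apply, he]
      by_cases h : n + 1 = j
      · have h' : n = j - 1 := by omega
        rw [if_pos h, if_pos h', h, RCLike.real_smul_eq_coe_mul, smul_eq_mul]
      · have h' : ¬ n = j - 1 := by omega
        rw [if_neg h, if_neg h', smul_zero, smul_zero]
    · intro x ε hε
      have h := lp.hasSum_single hp x
      obtain ⟨s, hs⟩ := (Metric.tendsto_atTop.1 h) ε hε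
      refine ⟨s, fun j => x j, ?_⟩
      have := hs s le_rfl
      rw [dist_comm, dist_eq_norm] at this
      have hj : ∀ j : ℤ, x j • (lp.single p j (1 : 𝕜) : lp (fun _ : ℤ => 𝕜) p)
          = lp.single p j (x j) := by
        intro j
        rw [← lp.single_smul]
        simp
      simp only [hj]
      exact this
  · refine window A (fun n x => x n) ?_ (lp.single p 0 (1 : 𝕜)) ?_ ?_ B hB
    · intro n x y
      exact lp.norm_apply_le_norm hp0.ne' (x - y) n
    · simp [he]
    · intro n hn
      simp [he, hn]

end lpcase

section c0case
variable (𝕜 : Type) [RCLike 𝕜]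

theorem c0_norm_le (f : ZeroAtInftyContinuousMap ℤ 𝕜) {C : ℝ} (hC : 0 ≤ C)
    (h : ∀ n, ‖f n‖ ≤ C) : ‖f‖ ≤ C := by
  rw [← ZeroAtInftyContinuousMap.norm_toBCF_eq_norm]
  exact (BoundedContinuousFunction.norm_le hC).2 h

theorem c0_apply_le (f : ZeroAtInftyContinuousMap ℤ 𝕜) (n : ℤ) : ‖f n‖ ≤ ‖f‖ := by
  rw [← ZeroAtInftyContinuousMap.norm_toBCF_eq_norm]
  exact f.toBCF.norm_coe_le_norm n

theorem exists_shift_c0 (A : Set ℕ) :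
    ∃ B : ZeroAtInftyContinuousMap ℤ 𝕜 →L[𝕜] ZeroAtInftyContinuousMap ℤ 𝕜,
      ∀ (x : ZeroAtInftyContinuousMap ℤ 𝕜) (n : ℤ), B x n = wgt A (n + 1) • x (n + 1) := by
  have hterm : ∀ (x : ZeroAtInftyContinuousMap ℤ 𝕜) (n : ℤ),
      ‖wgt A (n + 1) • x (n + 1)‖ ≤ 2 * ‖x (n + 1)‖ := by
    intro x n
    rw [norm_smul, Real.norm_eq_abs, abs_of_pos (wgt_pos A _)]
    exact mul_le_mul_of_nonneg_right (wgt_le A _) (norm_nonneg _)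
  have hz : ∀ (x : ZeroAtInftyContinuousMap ℤ 𝕜),
      Tendsto (fun n : ℤ => (wgt A (n + 1) • x (n + 1) : 𝕜)) (cocompact ℤ) (𝓝 0) := by
    intro x
    have h0 : Tendsto (fun n : ℤ => n + 1) (cocompact ℤ) (cocompact ℤ) := by
      rw [cocompact_eq_cofinite]
      exact (Equiv.addRight (1 : ℤ)).injective.tendsto_cofinite
    have h1 := ((x.zero_at_infty'.comp h0).norm).const_mul 2
    simp only [norm_zero, mul_zero] at h1
    exact squeeze_zero_norm (hterm x) h1
  let L : ZeroAtInftyContinuousMap ℤ 𝕜 →ₗ[𝕜] ZeroAtInftyContinuousMap ℤ 𝕜 :=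
    { toFun := fun x => ⟨⟨fun n : ℤ => (wgt A (n + 1) • x (n + 1) : 𝕜),
        continuous_of_discreteTopology⟩, hz x⟩
      map_add' := by
        intro x y
        ext n
        change wgt A (n + 1) • (x (n + 1) + y (n + 1)) = _
        rw [smul_add]
        rfl
      map_smul' := by
        intro r x
        ext n
        change wgt A (n + 1) • (r • x (n + 1)) = r • (wgt A (n + 1) • x (n + 1))
        rw [smul_comm] }
  refine ⟨L.mkContinuous 2 ?_, fun x n => rfl⟩
  intro x
  refine c0_norm_le 𝕜 _ (by positivity) fun n => ?_
  refine (hterm x n).trans ?_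
  exact mul_le_mul_of_nonneg_left (c0_apply_le 𝕜 x _) (by norm_num)

/-- Canonical basis of `c₀`. -/
noncomputable def c0e (j : ℤ) : ZeroAtInftyContinuousMap ℤ 𝕜 :=
  ⟨⟨fun n => if n = j then 1 else 0, continuous_of_discreteTopology⟩, by
    rw [cocompact_eq_cofinite]
    refine tendsto_const_nhds.congr' ?_
    have : ∀ᶠ n : ℤ in cofinite, n ≠ j := (Set.finite_singleton j).compl_mem_cofinite
    filter_upwards [this] with n hn
    simp [hn]⟩

theorem c0e_apply (j n : ℤ) : c0e 𝕜 j n = if n = j then 1 else 0 := rfl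

theorem c0_case {F : Set (Set ℕ)} (hF : IsFamily F) (hfull : FullFamily F)
    {A : Set ℕ} (hA : A ∈ tildeFam F) :
    ∃ (w : ℤ → ℝ) (B : ZeroAtInftyContinuousMap ℤ 𝕜 →L[𝕜] ZeroAtInftyContinuousMap ℤ 𝕜),
        IsInvertibleWBSc0 𝕜 w B ∧ FMix ⇑B F ∧
          ∃ W : Set (ZeroAtInftyContinuousMap ℤ 𝕜), IsOpen W ∧ W.Nonempty ∧
            nset ⇑B W W ⊆ A ∪ {0} := by
  obtain ⟨B, hB⟩ := exists_shift_c0 𝕜 A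
  refine ⟨wgt A, B, ⟨wgt_pos A, ⟨2, wgt_le A⟩, ⟨1 / 2, by norm_num, le_wgt A⟩, hB⟩, ?_, ?_⟩
  · refine mixing_of_tilde hF hfull hA (c0e 𝕜) ?_ B ?_ ?_
    · intro j
      refine c0_norm_le 𝕜 _ zero_le_one fun n => ?_
      rw [c0e_apply]
      split_ifs <;> simp
    · intro j
      ext n
      rw [hB, c0e_apply, ZeroAtInftyContinuousMap.smul_apply, c0e_apply]
      by_cases h : n + 1 = j
      · have h' : n = j - 1 := by omega
        rw [if_pos h, if_pos h', h, RCLike.real_smul_eq_coe_mul, smul_eq_mul]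
      · have h' : ¬ n = j - 1 := by omega
        rw [if_neg h, if_neg h', smul_zero, smul_zero]
    · intro x ε hε
      have hx : Tendsto x cofinite (𝓝 0) := by
        rw [← cocompact_eq_cofinite]; exact x.zero_at_infty'
      have hfin : {n : ℤ | ¬ ‖x n‖ < ε / 2}.Finite := by
        have := hx.norm.eventually_lt_const (u := ε / 2) (by simpa using half_pos hε)
        exact this
      refine ⟨hfin.toFinset, fun j => x j, ?_⟩
      refine lt_of_le_of_lt (c0_norm_le 𝕜 _ (half_pos hε).le fun n => ?_) (half_lt_self hε)
      have hsum : (∑ j ∈ hfin.toFinset, x j • c0e 𝕜 j : ZeroAtInftyContinuousMap ℤ 𝕜) n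
          = ∑ j ∈ hfin.toFinset, x j * (if n = j then 1 else 0) := by
        have : ∀ s : Finset ℤ, (∑ j ∈ s, x j • c0e 𝕜 j : ZeroAtInftyContinuousMap ℤ 𝕜) n
          = ∑ j ∈ s, x j * (if n = j then 1 else 0) := by
          intro s
          induction s using Finset.induction_on with
          | empty => simp
          | insert a s ha ih =>
            rw [Finset.sum_insert ha, Finset.sum_insert ha, ZeroAtInftyContinuousMap.add_apply, ih]
            rfl
        exact this _
      rw [ZeroAtInftyContinuousMap.sub_apply, hsum]
      simp only [mul_ite, mul_one, mul_zero, Finset.sum_ite_eq]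
      split_ifs with h
      · simp [(half_pos hε).le]
      · rw [Set.Finite.mem_toFinset, Set.mem_setOf_eq, not_not] at h
        rw [sub_zero]
        exact h.le
  · refine window A (fun n x => x n) ?_ (c0e 𝕜 0) ?_ ?_ B hB
    · intro n x y
      exact c0_apply_le 𝕜 (x - y) n
    · simp [c0e_apply]
    · intro n hn
      simp [c0e_apply, hn]

end c0case

/-- **Weiss–Akin–Glasner Lemma for operators.** Let `F` be a full
Furstenberg family, `A ⊆ ℕ` and let `X = c₀(ℤ)` or `ℓᵖ(ℤ)`, `1 ≤ p < ∞`. Then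
`A ∈ F̃` iff there is an invertible `F`-mixing bilateral weighted backward shift `B_w`
on `X` and a nonempty open `W ⊆ X` with `N_{B_w}(W,W) ⊆ A ∪ {0}`. -/
theorem mem_tildeFam_iff_realized_by_invertible_fMixing_shift
    (F : Set (Set ℕ)) (hF : IsFamily F) (hfull : FullFamily F)
    (A : Set ℕ) (𝕜 : Type) [RCLike 𝕜] :
    (∀ (p : ℝ≥0∞) [Fact (1 ≤ p)], p ≠ ∞ →
      (A ∈ tildeFam F ↔
        ∃ (w : ℤ → ℝ) (B : lp (fun _ : ℤ => 𝕜) p →L[𝕜] lp (fun _ : ℤ => 𝕜) p),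
          IsInvertibleWBSlp 𝕜 p w B ∧ FMix ⇑B F ∧
            ∃ W : Set (lp (fun _ : ℤ => 𝕜) p), IsOpen W ∧ W.Nonempty ∧
              nset ⇑B W W ⊆ A ∪ {0})) ∧
    (A ∈ tildeFam F ↔
      ∃ (w : ℤ → ℝ) (B : ZeroAtInftyContinuousMap ℤ 𝕜 →L[𝕜] ZeroAtInftyContinuousMap ℤ 𝕜),
        IsInvertibleWBSc0 𝕜 w B ∧ FMix ⇑B F ∧
          ∃ W : Set (ZeroAtInftyContinuousMap ℤ 𝕜), IsOpen W ∧ W.Nonempty ∧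
            nset ⇑B W W ⊆ A ∪ {0}) := by
  constructor
  · intro p _ hp
    constructor
    · exact fun hA => lp_case 𝕜 p hp hF hfull hA
    · rintro ⟨w, B, -, hmix, W, hW, nW, hsub⟩
      exact tilde_of_mixing B.continuous hF hfull hmix hW nW hsub
  · constructor
    · exact fun hA => c0_case 𝕜 hF hfull hA
    · rintro ⟨w, B, -, hmix, W, hW, nW, hsub⟩
      exact tilde_of_mixing B.continuous hF hfull hmix hW nW hsub
end

section
/- Let F be a shift-invariant thick Furstenberg family and suppose that every F*-transitive operator is weakly mixing. Then for an operator T : X → X the following are equivalent: (1) T is F*-transitive; (2) for every F-transitive operator S : Y → Y, the direct sum T ⊕ S is weakly mixing; (3) for every invertible F-transitive bilateral weighted backward shift S on Y, where Y = c₀(ℤ) or ℓ^p(ℤ), 1 ≤ p < ∞, the direct sum T ⊕ S is weakly mixing. -/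
open Set Topology Function Filter
open scoped ENNReal

/- ### Dynamics -/

lemma wmix_inter {X : Type*} [TopologicalSpace X] {T : X → X} (hc : Continuous T)
    (h : WMix T) {U₁ V₁ U₂ V₂ : Set X} (hU₁ : IsOpen U₁) (hV₁ : IsOpen V₁) (hU₂ : IsOpen U₂)
    (hV₂ : IsOpen V₂) (nU₁ : U₁.Nonempty) (nV₁ : V₁.Nonempty) (nU₂ : U₂.Nonempty)
    (nV₂ : V₂.Nonempty) :
    ∃ U V : Set X, IsOpen U ∧ IsOpen V ∧ U.Nonempty ∧ V.Nonempty ∧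
      nset T U V ⊆ nset T U₁ V₁ ∩ nset T U₂ V₂ := by
  have hit : ∀ (n : ℕ) (p : X × X), (prodMap' T T)^[n] p = (T^[n] p.1, T^[n] p.2) := by
    intro n
    induction n with
    | zero => intro p; rfl
    | succ n ih => intro p; rw [iterate_succ_apply, ih]; rfl
  obtain ⟨k, ⟨x, y⟩, hxy, hxy'⟩ := h (U₁ ×ˢ V₁) (U₂ ×ˢ V₂) (hU₁.prod hV₁) (hU₂.prod hV₂)
    (nU₁.prod nV₁) (nU₂.prod nV₂)
  rw [hit] at hxy'
  refine ⟨U₁ ∩ T^[k] ⁻¹' U₂, V₁ ∩ T^[k] ⁻¹' V₂, hU₁.inter (hU₂.preimage (hc.iterate k)),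
    hV₁.inter (hV₂.preimage (hc.iterate k)), ⟨x, hxy.1, hxy'.1⟩, ⟨y, hxy.2, hxy'.2⟩, ?_⟩
  rintro n ⟨z, ⟨hz1, hz2⟩, hz3, hz4⟩
  refine ⟨⟨z, hz1, hz3⟩, ⟨T^[k] z, hz2, ?_⟩⟩
  have : T^[n] (T^[k] z) = T^[k] (T^[n] z) := by
    rw [← iterate_add_apply, ← iterate_add_apply, add_comm]
  rw [this]; exact hz4

lemma wmix_of_thick {X : Type*} [TopologicalSpace X] {T : X → X} (hc : Continuous T)
    (h : ∀ U V : Set X, IsOpen U → IsOpen V → U.Nonempty → V.Nonempty →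
      IsThickSet (nset T U V)) : WMix T := by
  have hit : ∀ (n : ℕ) (p : X × X), (prodMap' T T)^[n] p = (T^[n] p.1, T^[n] p.2) := by
    intro n
    induction n with
    | zero => intro p; rfl
    | succ n ih => intro p; rw [iterate_succ_apply, ih]; rfl
  have key : ∀ U V₁ V₂ : Set X, IsOpen U → IsOpen V₁ → IsOpen V₂ → U.Nonempty → V₁.Nonempty →
      V₂.Nonempty → (nset T U V₁ ∩ nset T U V₂).Nonempty := by
    intro U V₁ V₂ hU h1 h2 nU n1 n2
    obtain ⟨m, hm⟩ := h V₁ V₂ h1 h2 n1 n2 0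
    obtain ⟨x, hx, hx'⟩ := hm 0 le_rfl
    simp only [add_zero] at hx'
    obtain ⟨n, hn⟩ := h U (V₁ ∩ T^[m] ⁻¹' V₂) hU (h1.inter (h2.preimage (hc.iterate m))) nU
      ⟨x, hx, hx'⟩ m
    obtain ⟨y, hy, hy'⟩ := hn m le_rfl
    obtain ⟨z, hz, hz'⟩ := hn 0 (Nat.zero_le _)
    refine ⟨n + m, ⟨y, hy, hy'.1⟩, ⟨z, hz, ?_⟩⟩
    rw [add_comm, iterate_add_apply]
    exact hz'.2
  intro U V hU hV ⟨⟨u1, u2⟩, hu⟩ ⟨⟨v1, v2⟩, hv⟩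
  obtain ⟨U₁, U₂, hU₁, hU₂, mu1, mu2, hsU⟩ := isOpen_prod_iff.1 hU u1 u2 hu
  obtain ⟨V₁, V₂, hV₁, hV₂, mv1, mv2, hsV⟩ := isOpen_prod_iff.1 hV v1 v2 hv
  obtain ⟨m, hm⟩ := h U₁ U₂ hU₁ hU₂ ⟨_, mu1⟩ ⟨_, mu2⟩ 0
  obtain ⟨x, hx, hx'⟩ := hm 0 le_rfl
  simp only [add_zero] at hx'
  have hne : (T^[m] ⁻¹' V₂).Nonempty := by
    obtain ⟨q, hq⟩ := h V₂ V₂ hV₂ hV₂ ⟨_, mv2⟩ ⟨_, mv2⟩ m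
    obtain ⟨y, _, hy⟩ := hq m le_rfl
    rw [add_comm, iterate_add_apply] at hy
    exact ⟨_, hy⟩
  obtain ⟨n, ⟨y, hy, hy'⟩, ⟨z, hz, hz'⟩⟩ := key (U₁ ∩ T^[m] ⁻¹' U₂) V₁ (T^[m] ⁻¹' V₂)
    (hU₁.inter (hU₂.preimage (hc.iterate m))) hV₁ (hV₂.preimage (hc.iterate m)) ⟨x, hx, hx'⟩
    ⟨_, mv1⟩ hne
  refine ⟨n, (y, T^[m] z), hsU ⟨hy.1, hz.2⟩, ?_⟩
  rw [hit]
  refine hsV ⟨hy', ?_⟩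
  have : T^[n] (T^[m] z) = T^[m] (T^[n] z) := by
    rw [← iterate_add_apply, ← iterate_add_apply, add_comm]
  show T^[n] (T^[m] z) ∈ V₂
  rw [this]; exact hz'

lemma prodMap'_iterate_s12 {X Y : Type*} (T : X → X) (S : Y → Y) (n : ℕ) (p : X × Y) :
    (prodMap' T S)^[n] p = (T^[n] p.1, S^[n] p.2) := by
  induction n generalizing p with
  | zero => rfl
  | succ n ih => rw [iterate_succ_apply, ih]; rfl

/-- The direction (1) ⇒ (2), (3), for arbitrary topological spaces. -/
lemma prod_wmix {X Y : Type*} [TopologicalSpace X] [TopologicalSpace Y] {T : X → X} {S : Y → Y}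
    (hT : Continuous T) (hS : Continuous S) {F : Set (Set ℕ)} (hF : IsFamily F)
    (hth : ThickFamily F) (hTw : WMix T) (hTF : FTrans T (dualFam F)) (hSF : FTrans S F) :
    WMix (prodMap' T S) := by
  have hSw : WMix S := by
    refine wmix_of_thick hS fun U V hU hV nU nV k => ?_
    have h1 := hth _ (hSF U V hU hV nU nV) k
    by_contra hcon
    refine hF.2.2 ?_
    convert h1 using 1
    symm
    rw [Set.eq_empty_iff_forall_notMem]
    intro n hn
    exact hcon ⟨n, hn⟩
  intro U V hU hV ⟨⟨⟨a, b⟩, ⟨c, d⟩⟩, hu⟩ ⟨⟨⟨a', b'⟩, ⟨c', d'⟩⟩, hv⟩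
  obtain ⟨P, Q, hP, hQ, mP, mQ, hs⟩ := isOpen_prod_iff.1 hU _ _ hu
  obtain ⟨P', Q', hP', hQ', mP', mQ', hs'⟩ := isOpen_prod_iff.1 hV _ _ hv
  obtain ⟨A, B, hA, hB, mA, mB, hAB⟩ := isOpen_prod_iff.1 hP _ _ mP
  obtain ⟨C, D, hC, hD, mC, mD, hCD⟩ := isOpen_prod_iff.1 hQ _ _ mQ
  obtain ⟨A', B', hA', hB', mA', mB', hAB'⟩ := isOpen_prod_iff.1 hP' _ _ mP'
  obtain ⟨C', D', hC', hD', mC', mD', hCD'⟩ := isOpen_prod_iff.1 hQ' _ _ mQ'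
  obtain ⟨W, Z, hW, hZ, nW, nZ, hWZ⟩ := wmix_inter hT hTw hA hA' hC hC' ⟨_, mA⟩ ⟨_, mA'⟩
    ⟨_, mC⟩ ⟨_, mC'⟩
  obtain ⟨W', Z', hW', hZ', nW', nZ', hWZ'⟩ := wmix_inter hS hSw hB hB' hD hD' ⟨_, mB⟩ ⟨_, mB'⟩
    ⟨_, mD⟩ ⟨_, mD'⟩
  obtain ⟨n, hn, hn'⟩ := hTF W Z hW hZ nW nZ _ (hSF W' Z' hW' hZ' nW' nZ')
  obtain ⟨⟨x, hx, hx'⟩, ⟨y, hy, hy'⟩⟩ := hWZ hn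
  obtain ⟨⟨z, hz, hz'⟩, ⟨t, ht, ht'⟩⟩ := hWZ' hn'
  refine ⟨n, ((x, z), (y, t)), hs ⟨hAB ⟨hx, hz⟩, hCD ⟨hy, ht⟩⟩, ?_⟩
  rw [prodMap'_iterate_s12, prodMap'_iterate_s12, prodMap'_iterate_s12]
  exact hs' ⟨hAB' ⟨hx', hz'⟩, hCD' ⟨hy', ht'⟩⟩

/-- Weak mixing of a product forces the return sets of the factors to meet. -/
lemma nset_inter_of_prod_wmix {X Y : Type*} [TopologicalSpace X] [TopologicalSpace Y]
    {T : X → X} {S : Y → Y} (h : WMix (prodMap' T S)) {U V : Set X} {W Z : Set Y}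
    (hU : IsOpen U) (hV : IsOpen V) (hW : IsOpen W) (hZ : IsOpen Z)
    (nU : U.Nonempty) (nV : V.Nonempty) (nW : W.Nonempty) (nZ : Z.Nonempty) :
    (nset T U V ∩ nset S W Z).Nonempty := by
  obtain ⟨n, p, hp, hp'⟩ := h ((U ×ˢ W) ×ˢ (U ×ˢ W)) ((V ×ˢ Z) ×ˢ (V ×ˢ Z))
    ((hU.prod hW).prod (hU.prod hW)) ((hV.prod hZ).prod (hV.prod hZ))
    ((nU.prod nW).prod (nU.prod nW)) ((nV.prod nZ).prod (nV.prod nZ))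
  rw [prodMap'_iterate_s12, prodMap'_iterate_s12] at hp'
  exact ⟨n, ⟨p.1.1, hp.1.1, hp'.1.1⟩, ⟨p.1.2, hp.1.2, hp'.1.2⟩⟩

/- ### The weighted shift attached to a set `A` -/

noncomputable section

/-- The obstacle set `{0} ∪ (ℕ ∖ A)` inside `ℤ`. -/
def obst (A : Set ℕ) : Set ℤ := {k | k = 0 ∨ ∃ n : ℕ, n ∉ A ∧ k = n}

/-- The distance to the obstacle set. -/
def phi (A : Set ℕ) (k : ℤ) : ℝ := Metric.infDist k (obst A)

lemma obst_nonempty (A : Set ℕ) : (obst A).Nonempty := ⟨0, Or.inl rfl⟩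

lemma phi_lip (A : Set ℕ) (j k : ℤ) : phi A j ≤ phi A k + |(j : ℝ) - k| := by
  have := Metric.infDist_le_infDist_add_dist (s := obst A) (x := j) (y := k)
  rwa [Int.dist_eq] at this

lemma phi_zero (A : Set ℕ) : phi A 0 = 0 := Metric.infDist_zero_of_mem (Or.inl rfl)

lemma phi_notMem {A : Set ℕ} {n : ℕ} (hn : n ∉ A) : phi A n = 0 :=
  Metric.infDist_zero_of_mem (Or.inr ⟨n, hn, rfl⟩)

/-- The good times. -/
def good (A : Set ℕ) (K : ℕ) : Set ℕ := {n | (K : ℝ) ≤ phi A n ∧ (K : ℝ) ≤ phi A (-n)}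

lemma good_anti (A : Set ℕ) {K L : ℕ} (h : K ≤ L) : good A L ⊆ good A K := by
  intro n hn
  have : (K : ℝ) ≤ L := by exact_mod_cast h
  exact ⟨this.trans hn.1, this.trans hn.2⟩

lemma good_mem {F : Set (Set ℕ)} (hF : IsFamily F) (hsi : ShiftInvariant F)
    (hth : ThickFamily F) {A : Set ℕ} (hA : A ∈ F) (K : ℕ) : good A K ∈ F := by
  refine hF.2.1 (hsi _ (hth A hA (2 * K)) K) ?_
  rintro n ⟨m, hm, hnm⟩
  have hnm' : n = m + K := by omega
  constructor
  · refine (Metric.le_infDist (obst_nonempty A)).2 ?_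
    rintro y (rfl | ⟨l, hl, rfl⟩)
    · rw [Int.dist_eq, hnm']
      push_cast
      rw [sub_zero, abs_of_nonneg (by positivity)]
      linarith [Nat.cast_nonneg (α := ℝ) m]
    · rw [Int.dist_eq]
      by_contra hcon
      push Not at hcon
      have h2 : |(n : ℤ) - l| < K := by exact_mod_cast hcon
      rw [abs_lt] at h2
      have := hm (l - m) (by omega)
      rw [show m + (l - m) = l by omega] at this
      exact hl this
  · refine (Metric.le_infDist (obst_nonempty A)).2 ?_
    have hK : (K : ℝ) ≤ n := by exact_mod_cast (by omega : K ≤ n)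
    rintro y (rfl | ⟨l, hl, rfl⟩)
    · rw [Int.dist_eq]
      push_cast
      rw [sub_zero, abs_neg, abs_of_nonneg (by positivity)]
      exact hK
    · rw [Int.dist_eq]
      push_cast
      rw [show -(n : ℝ) - l = -(n + l) by ring, abs_neg, abs_of_nonneg (by positivity)]
      linarith [Nat.cast_nonneg (α := ℝ) l]

/-- The weights. -/
def wt (A : Set ℕ) (k : ℤ) : ℝ := Real.exp (phi A k - phi A (k - 1))

lemma wt_le (A : Set ℕ) (k : ℤ) : wt A k ≤ Real.exp 1 := by
  refine Real.exp_le_exp.2 ?_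
  have := phi_lip A k (k - 1)
  push_cast at this
  simp only [sub_sub_cancel, abs_one] at this
  linarith

lemma le_wt (A : Set ℕ) (k : ℤ) : Real.exp (-1) ≤ wt A k := by
  refine Real.exp_le_exp.2 ?_
  have := phi_lip A (k - 1) k
  push_cast at this
  rw [show (k : ℝ) - 1 - k = -1 by ring, abs_neg, abs_one] at this
  linarith

/-- The space `ℓ¹(ℤ)`. -/
abbrev L1Z : Type := lp (fun _ : ℤ => ℝ) 1

lemma L1Z_norm (x : L1Z) : ‖x‖ = ∑' k, ‖x k‖ := by
  rw [lp.norm_eq_tsum_rpow (by simp)]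
  simp

lemma L1Z_summable (x : L1Z) : Summable fun k => ‖x k‖ := by
  have := (lp.memℓp x).summable (by simp)
  simpa using this

lemma L1Z_bound (A : Set ℕ) (x : L1Z) (n : ℤ) :
    ‖wt A (n + 1) * x (n + 1)‖ ≤ Real.exp 1 * ‖x (n + 1)‖ := by
  have hw : ‖wt A (n + 1)‖ = wt A (n + 1) := Real.norm_of_nonneg (Real.exp_pos _).le
  rw [norm_mul, hw]
  exact mul_le_mul_of_nonneg_right (wt_le A _) (norm_nonneg _)

lemma L1Z_shift_summable (x : L1Z) : Summable fun k : ℤ => Real.exp 1 * ‖x (k + 1)‖ :=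
  (((Equiv.addRight (1 : ℤ)).summable_iff.2 (L1Z_summable x))).mul_left _

lemma L1Z_mem (A : Set ℕ) (x : L1Z) :
    Memℓp (fun n : ℤ => wt A (n + 1) * x (n + 1)) 1 := by
  refine memℓp_gen ?_
  simp only [ENNReal.toReal_one, Real.rpow_one]
  exact Summable.of_nonneg_of_le (fun _ => norm_nonneg _) (L1Z_bound A x) (L1Z_shift_summable x)

/-- The weighted backward shift. -/
def Bw (A : Set ℕ) : L1Z →L[ℝ] L1Z :=
  LinearMap.mkContinuous
    { toFun := fun x => (⟨fun n : ℤ => wt A (n + 1) * x (n + 1), L1Z_mem A x⟩ : L1Z)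
      map_add' := by
        intro x y
        ext n
        exact mul_add _ _ _
      map_smul' := by
        intro c x
        ext n
        simp only [lp.coeFn_smul, Pi.smul_apply, smul_eq_mul, RingHom.id_apply]
        ring }
    (Real.exp 1) (by
      intro x
      rw [L1Z_norm, L1Z_norm x, ← (Equiv.addRight (1 : ℤ)).tsum_eq (fun k => ‖x k‖), ← tsum_mul_left]
      exact (Summable.of_nonneg_of_le (fun _ => norm_nonneg _) (L1Z_bound A x)
        (L1Z_shift_summable x)).tsum_le_tsum (L1Z_bound A x) (L1Z_shift_summable x))

lemma Bw_apply (A : Set ℕ) (x : L1Z) (n : ℤ) : Bw A x n = wt A (n + 1) * x (n + 1) := rfl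

lemma Bw_iter (A : Set ℕ) (n : ℕ) (x : L1Z) (j : ℤ) :
    ((Bw A)^[n] x) j = Real.exp (phi A (j + n) - phi A j) * x (j + n) := by
  induction n generalizing x with
  | zero => simp
  | succ n ih =>
    rw [iterate_succ_apply, ih, Bw_apply, wt, ← mul_assoc, ← Real.exp_add]
    congr 2
    · rw [show j + (n : ℤ) + 1 - 1 = j + n by ring]
      push_cast
      rw [add_assoc]
      ring
    · push_cast
      rw [add_assoc]

lemma Bw_isWBS (A : Set ℕ) : IsInvertibleWBSlp ℝ 1 (wt A) (Bw A) :=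
  ⟨fun _ => Real.exp_pos _, ⟨_, wt_le A⟩, ⟨_, Real.exp_pos _, le_wt A⟩, fun _ _ => rfl⟩

/-- The unit vectors. -/
def ev (k : ℤ) : L1Z := lp.single 1 k (1 : ℝ)

lemma ev_apply (k j : ℤ) : ev k j = if j = k then 1 else 0 := by
  rw [ev, lp.coeFn_single, Pi.single_apply]

lemma ev_norm (k : ℤ) : ‖ev k‖ = 1 := by
  rw [ev, lp.norm_single (by simp)]
  simp

lemma span_ev_dense : Dense (Submodule.span ℝ (Set.range ev) : Set L1Z) := by
  intro x
  have h := lp.hasSum_single (E := fun _ : ℤ => ℝ) (p := 1) (by simp) x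
  refine mem_closure_of_tendsto h (Eventually.of_forall fun s => ?_)
  refine Submodule.sum_mem _ fun k _ => ?_
  have : lp.single 1 k (x k) = (x k) • ev k := by
    rw [ev, ← lp.single_smul]; simp
  rw [this]
  exact Submodule.smul_mem _ _ (Submodule.subset_span ⟨k, rfl⟩)

lemma Bw_iter_pow (A : Set ℕ) (n : ℕ) (x : L1Z) : (Bw A)^[n] x = ((Bw A) ^ n) x := by
  induction n generalizing x with
  | zero => rfl
  | succ n ih => rw [iterate_succ_apply, ih, pow_succ]; rfl

lemma Bw_iter_ev (A : Set ℕ) (n : ℕ) (k : ℤ) :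
    (Bw A)^[n] (ev k) = Real.exp (phi A k - phi A (k - n)) • ev (k - n) := by
  ext j
  rw [Bw_iter, lp.coeFn_smul, Pi.smul_apply, ev_apply, ev_apply, smul_eq_mul]
  by_cases h : j = k - n
  · subst h; simp
  · rw [if_neg h, if_neg (by omega)]; simp

lemma exp_small {ε : ℝ} (hε : 0 < ε) (c : ℝ) : ∃ K : ℕ, Real.exp (c - K) < ε := by
  obtain ⟨K, hK⟩ := exists_nat_gt (c - Real.log ε)
  refine ⟨K, ?_⟩
  rw [← Real.lt_log_iff_exp_lt hε]
  linarith

lemma fwd_small (A : Set ℕ) {x : L1Z} (hx : x ∈ Submodule.span ℝ (Set.range ev)) :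
    ∀ ε > 0, ∃ K : ℕ, ∀ n ∈ good A K, ‖((Bw A) ^ n) x‖ < ε := by
  induction hx using Submodule.span_induction with
  | mem x h =>
    obtain ⟨k, rfl⟩ := h
    intro ε hε
    obtain ⟨K, hK⟩ := exp_small hε (phi A k + |(k : ℝ)|)
    refine ⟨K, fun n hn => ?_⟩
    rw [← Bw_iter_pow, Bw_iter_ev, norm_smul, ev_norm, mul_one,
      Real.norm_of_nonneg (Real.exp_pos _).le]
    refine (Real.exp_le_exp.2 ?_).trans_lt hK
    have h1 := phi_lip A (-n) (k - n)
    push_cast at h1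
    rw [show -(n : ℝ) - (k - n) = -k by ring, abs_neg] at h1
    linarith [hn.2]
  | zero => intro ε hε; exact ⟨0, fun n _ => by simpa using hε⟩
  | add x y _ _ ihx ihy =>
    intro ε hε
    obtain ⟨K, hK⟩ := ihx (ε / 2) (by positivity)
    obtain ⟨L, hL⟩ := ihy (ε / 2) (by positivity)
    refine ⟨max K L, fun n hn => ?_⟩
    rw [map_add]
    refine (norm_add_le _ _).trans_lt ?_
    linarith [hK n (good_anti A (le_max_left _ _) hn), hL n (good_anti A (le_max_right _ _) hn)]
  | smul c x _ ih =>
    intro ε hε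
    obtain ⟨K, hK⟩ := ih (ε / (‖c‖ + 1)) (by positivity)
    refine ⟨K, fun n hn => ?_⟩
    have := hK n hn
    rw [lt_div_iff₀ (by positivity)] at this
    rw [map_smul, norm_smul]
    nlinarith [norm_nonneg (((Bw A) ^ n) x)]

lemma bwd_small (A : Set ℕ) {x : L1Z} (hx : x ∈ Submodule.span ℝ (Set.range ev)) :
    ∀ ε > 0, ∃ K : ℕ, ∀ n ∈ good A K, ∃ z : L1Z, ‖z‖ < ε ∧ ((Bw A) ^ n) z = x := by
  induction hx using Submodule.span_induction with
  | mem x h =>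
    obtain ⟨k, rfl⟩ := h
    intro ε hε
    obtain ⟨K, hK⟩ := exp_small hε (phi A k + |(k : ℝ)|)
    refine ⟨K, fun n hn => ⟨Real.exp (phi A k - phi A (k + n)) • ev (k + n), ?_, ?_⟩⟩
    · rw [norm_smul, ev_norm, mul_one, Real.norm_of_nonneg (Real.exp_pos _).le]
      refine (Real.exp_le_exp.2 ?_).trans_lt hK
      have h1 := phi_lip A n (k + n)
      push_cast at h1
      rw [show (n : ℝ) - (k + n) = -k by ring, abs_neg] at h1
      linarith [hn.1]
    · rw [map_smul, ← Bw_iter_pow, Bw_iter_ev, smul_smul, ← Real.exp_add]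
      simp
  | zero => intro ε hε; exact ⟨0, fun n _ => ⟨0, by simpa using hε, by simp⟩⟩
  | add x y _ _ ihx ihy =>
    intro ε hε
    obtain ⟨K, hK⟩ := ihx (ε / 2) (by positivity)
    obtain ⟨L, hL⟩ := ihy (ε / 2) (by positivity)
    refine ⟨max K L, fun n hn => ?_⟩
    obtain ⟨z, hz, hz'⟩ := hK n (good_anti A (le_max_left _ _) hn)
    obtain ⟨t, ht, ht'⟩ := hL n (good_anti A (le_max_right _ _) hn)
    refine ⟨z + t, ?_, by rw [map_add, hz', ht']⟩
    refine (norm_add_le _ _).trans_lt ?_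
    linarith
  | smul c x _ ih =>
    intro ε hε
    obtain ⟨K, hK⟩ := ih (ε / (‖c‖ + 1)) (by positivity)
    refine ⟨K, fun n hn => ?_⟩
    obtain ⟨z, hz, hz'⟩ := hK n hn
    refine ⟨c • z, ?_, by rw [map_smul, hz']⟩
    rw [lt_div_iff₀ (by positivity)] at hz
    rw [norm_smul]
    nlinarith [norm_nonneg z]

lemma Bw_FTrans {F : Set (Set ℕ)} (hF : IsFamily F) (hsi : ShiftInvariant F)
    (hth : ThickFamily F) {A : Set ℕ} (hA : A ∈ F) : FTrans (Bw A) F := by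
  intro U V hU hV nU nV
  obtain ⟨x, hxU, hx⟩ := span_ev_dense.inter_open_nonempty U hU nU
  obtain ⟨y, hyV, hy⟩ := span_ev_dense.inter_open_nonempty V hV nV
  obtain ⟨ε, hε, hεU⟩ := Metric.isOpen_iff.1 hU x hxU
  obtain ⟨δ, hδ, hδV⟩ := Metric.isOpen_iff.1 hV y hyV
  obtain ⟨K, hK⟩ := fwd_small A hx δ hδ
  obtain ⟨L, hL⟩ := bwd_small A hy ε hε
  refine hF.2.1 (good_mem hF hsi hth hA (max K L)) fun n hn => ?_
  have h1 := hK n (good_anti A (le_max_left _ _) hn)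
  obtain ⟨z, hz, hz'⟩ := hL n (good_anti A (le_max_right _ _) hn)
  refine ⟨x + z, hεU ?_, ?_⟩
  · rw [mem_ball_iff_norm]; simpa using hz
  · rw [Bw_iter_pow, map_add, hz']
    refine hδV ?_
    rw [mem_ball_iff_norm]; simpa using h1

/-- The operator `Bw A` has a return set contained in `A`. -/
lemma Bw_nset (A : Set ℕ) : ∃ W Z : Set L1Z, IsOpen W ∧ IsOpen Z ∧ W.Nonempty ∧ Z.Nonempty ∧
    nset (Bw A) W Z ⊆ A := by
  refine ⟨Metric.ball 0 1, Metric.ball ((3 : ℝ) • ev 0) 1, Metric.isOpen_ball, Metric.isOpen_ball,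
    ⟨0, by simp⟩, ⟨(3 : ℝ) • ev 0, by simp⟩, ?_⟩
  rintro n ⟨x, hx, hx'⟩
  by_contra hn
  have h1 : ‖x (n : ℤ)‖ < 1 := by
    refine (lp.norm_apply_le_norm (by simp) x n).trans_lt ?_
    simpa using hx
  rw [mem_ball_iff_norm] at hx'
  have h2 := (lp.norm_apply_le_norm (by simp) _ (0 : ℤ)).trans_lt hx'
  rw [lp.coeFn_sub, Pi.sub_apply, Bw_iter, zero_add, phi_notMem hn, phi_zero, lp.coeFn_smul,
    Pi.smul_apply, ev_apply] at h2
  simp only [sub_self, Real.exp_zero, one_mul, if_true, smul_eq_mul, mul_one,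
    Real.norm_eq_abs] at h1 h2
  rw [abs_lt] at h1 h2
  linarith

lemma L1Z_infDim : ¬ FiniteDimensional ℝ L1Z := by
  intro h
  have hli : LinearIndependent ℝ ev := by
    rw [linearIndependent_iff']
    intro s g hg i hi
    have := congrArg (fun x : L1Z => x i) hg
    simp only [lp.coeFn_sum, Finset.sum_apply, lp.coeFn_smul, Pi.smul_apply, ev_apply] at this
    simpa [hi] using this
  have := hli.finite
  exact not_finite ℤ

lemma L1Z_sep : TopologicalSpace.SeparableSpace L1Z := by
  have h := (Set.countable_range ev).isSeparable.span (R := ℝ)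
  have h2 := h.closure
  rw [span_ev_dense.closure_eq] at h2
  exact TopologicalSpace.isSeparable_univ_iff.1 h2

/-- `Bw A` as a bundled operator. -/
def BwOp (A : Set ℕ) : FrechetOp :=
  haveI := L1Z_sep
  { 𝕜 := ℝ
    X := L1Z
    infDim := L1Z_infDim
    T := Bw A
    linear := (Bw A).toLinearMap.isLinear
    cont := (Bw A).continuous }

end

/-- If the return sets of `T` meet those of every shift `Bw A`, then `T` is `F*`-transitive. -/
lemma dual_of_Bw {X : Type*} [TopologicalSpace X] {T : X → X} {F : Set (Set ℕ)}
    (h : ∀ A ∈ F, WMix (prodMap' T (Bw A))) : FTrans T (dualFam F) := by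
  intro U V hU hV nU nV A hA
  obtain ⟨W, Z, hW, hZ, nW, nZ, hWZ⟩ := Bw_nset A
  obtain ⟨n, hn, hn'⟩ := nset_inter_of_prod_wmix (h A hA) hU hV hW hZ nU nV nW nZ
  exact ⟨n, hn, hWZ hn'⟩

/-- Let `F` be a shift-invariant thick Furstenberg family such that
every `F*`-transitive operator is weakly mixing. For an operator `T` the following are
equivalent: (1) `T` is `F*`-transitive; (2) `T ⊕ S` is weakly mixing for every
`F`-transitive operator `S`; (3) `T ⊕ S` is weakly mixing for every invertible
`F`-transitive bilateral weighted backward shift `S` on `c₀(ℤ)` or `ℓᵖ(ℤ)`,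
`1 ≤ p < ∞`. -/
theorem dualFam_transitive_iff_prod_weaklyMixing
    (F : Set (Set ℕ)) (hF : IsFamily F) (hsi : ShiftInvariant F) (hth : ThickFamily F)
    (hyp : ∀ S : FrechetOp, FTrans S.T (dualFam F) → WMix S.T)
    (T : FrechetOp) :
    (FTrans T.T (dualFam F) ↔
      ∀ S : FrechetOp, FTrans S.T F → WMix (prodMap' T.T S.T)) ∧
    (FTrans T.T (dualFam F) ↔
      ∀ (𝕜 : Type) [RCLike 𝕜],
        (∀ (p : ℝ≥0∞) [Fact (1 ≤ p)], p ≠ ∞ →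
          ∀ (w : ℤ → ℝ) (B : lp (fun _ : ℤ => 𝕜) p →L[𝕜] lp (fun _ : ℤ => 𝕜) p),
            IsInvertibleWBSlp 𝕜 p w B → FTrans ⇑B F → WMix (prodMap' T.T ⇑B)) ∧
        (∀ (w : ℤ → ℝ) (B : ZeroAtInftyContinuousMap ℤ 𝕜 →L[𝕜] ZeroAtInftyContinuousMap ℤ 𝕜),
            IsInvertibleWBSc0 𝕜 w B → FTrans ⇑B F → WMix (prodMap' T.T ⇑B))) := by
  refine ⟨⟨fun h S hS => prod_wmix T.cont S.cont hF hth (hyp T h) h hS, fun h => ?_⟩,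
    ⟨fun h 𝕜 _ => ⟨fun p _ _ w B _ hB =>
      prod_wmix T.cont B.continuous hF hth (hyp T h) h hB, fun w B _ hB =>
      prod_wmix T.cont B.continuous hF hth (hyp T h) h hB⟩, fun h => ?_⟩⟩
  · exact dual_of_Bw fun A hA => h (BwOp A) (Bw_FTrans hF hsi hth hA)
  · exact dual_of_Bw fun A hA =>
      (h ℝ).1 1 (by simp) (wt A) (Bw A) (Bw_isWBS A) (Bw_FTrans hF hsi hth hA)
end
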